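/- arXiv:1810.11329 — 6 statements merged into one kernel-verified Lean document; each statement's English description precedes it below -/
import Mathlib

section
/- Under the stated hypotheses there exists a center manifold: there is a neighborhood Ω ⊆ ℝ^d of the origin and a continuously differentiable map h : Ω → ℝ^m with h(0) = 0 and Dh(0) = 0 such that Dh(x)(F₁x + f̄₁(x, h(x))) = F₂ h(x) + f̄₂(x, h(x)) for all x ∈ Ω. -/
open Set Topology Filter NormedSpace

namespace CenterManifold

section LinearFlow

variable {V : Type*} [NormedAddCommGroup V] [NormedSpace ℝ V]

/-- Mean value inequality for a curve whose speed is dominated by an exponential. -/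
theorem norm_sub_le_of_norm_deriv_le_exp {φ φ' : ℝ → V} {a b c k : ℝ} (hk : k ≠ 0) (hab : a ≤ b)
    (hφ : ∀ t ∈ Icc a b, HasDerivAt φ (φ' t) t)
    (hb : ∀ t ∈ Icc a b, ‖φ' t‖ ≤ c * Real.exp (k * t)) :
    ‖φ b - φ a‖ ≤ c / k * (Real.exp (k * b) - Real.exp (k * a)) := by
  have hB : ∀ t, HasDerivAt (fun t => c / k * (Real.exp (k * t) - Real.exp (k * a)))
      (c * Real.exp (k * t)) t := fun t => by
    have h := ((((hasDerivAt_id t).const_mul k).exp).sub_const (Real.exp (k * a))).const_mul (c / k)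
    refine h.congr_deriv ?_
    simp only [id]
    field_simp
  refine image_norm_le_of_norm_deriv_right_le_deriv_boundary (f := fun t => φ t - φ a) (f' := φ')
    (fun t ht => ((hφ t ht).sub_const _).continuousAt.continuousWithinAt)
    (fun t ht => ((hφ t (Ico_subset_Icc_self ht)).sub_const _).hasDerivWithinAt)
    (by simp) hB (fun t ht => hb t (Ico_subset_Icc_self ht)) (right_mem_Icc.2 hab)

theorem exp_zero_smul_apply (L : V →L[ℝ] V) (v : V) : exp ((0 : ℝ) • L) v = v := by
  rw [zero_smul, exp_zero]; rfl

variable [CompleteSpace V]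

theorem exp_smul_mul_exp_smul (L : V →L[ℝ] V) (s t : ℝ) :
    exp (s • L) * exp (t • L) = exp ((s + t) • L) := by
  let _ : NormedAlgebra ℚ (V →L[ℝ] V) := NormedAlgebra.restrictScalars ℚ ℝ _
  rw [add_smul, exp_add_of_commute]
  exact ((Commute.refl L).smul_left s).smul_right t

theorem exp_smul_apply_exp_smul (L : V →L[ℝ] V) (s t : ℝ) (v : V) :
    exp (s • L) (exp (t • L) v) = exp ((s + t) • L) v := by
  rw [← exp_smul_mul_exp_smul]; rfl

theorem continuous_exp_smul (L : V →L[ℝ] V) : Continuous fun t : ℝ => exp (t • L) :=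
  continuous_iff_continuousAt.2 fun t => (hasDerivAt_exp_smul_const L t).continuousAt

/-- Variation of constants in differential form. -/
theorem hasDerivAt_exp_sub_smul_apply {L : V →L[ℝ] V} {z : ℝ → V} {g : V} {t : ℝ} (τ : ℝ)
    (hz : HasDerivAt z (L (z t) + g) t) :
    HasDerivAt (fun t => exp ((τ - t) • L) (z t)) (exp ((τ - t) • L) g) t := by
  have h1 : HasDerivAt (fun t : ℝ => exp ((τ - t) • L)) ((-1 : ℝ) • (exp ((τ - t) • L) * L)) t :=
    (hasDerivAt_exp_smul_const L (τ - t)).scomp t ((hasDerivAt_id t).const_sub τ)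
  refine (h1.clm_apply hz).congr_deriv ?_
  simp

theorem exists_hasDerivAt_linear (L : V →L[ℝ] V) {g : ℝ → V} (hg : Continuous g) (z₀ : V) :
    ∃ z : ℝ → V, (∀ t, z t = exp (t • L) (z₀ + ∫ s in (0 : ℝ)..t, exp ((-s) • L) (g s))) ∧
      ∀ t, HasDerivAt z (L (z t) + g t) t := by
  refine ⟨_, fun _ => rfl, fun t => ?_⟩
  have hc : Continuous fun s : ℝ => exp ((-s) • L) (g s) :=
    ((continuous_exp_smul L).comp continuous_neg).clm_apply hg
  have h := (hasDerivAt_exp_smul_const' L t).clm_apply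
    ((hc.integral_hasStrictDerivAt 0 t).hasDerivAt.const_add z₀)
  refine h.congr_deriv ?_
  rw [exp_smul_apply_exp_smul, add_neg_cancel, exp_zero_smul_apply]
  rfl

/-- A priori bound for the initial value problem of a linear flow growing slower than the forcing. -/
theorem norm_le_of_forced {A : V →L[ℝ] V} {C α lam δ c : ℝ}
    (hA : ∀ t, 0 ≤ t → ‖exp (t • A)‖ ≤ C * Real.exp (α * t)) (hC : 0 ≤ C) (hδ : 0 < δ)
    (hlam : α + δ ≤ lam) {x g : ℝ → V}
    (hx : ∀ t, 0 ≤ t → HasDerivAt x (A (x t) + g t) t)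
    (hg : ∀ t, 0 ≤ t → ‖g t‖ ≤ c * Real.exp (lam * t)) {τ : ℝ} (hτ : 0 ≤ τ) :
    ‖x τ‖ ≤ (C * ‖x 0‖ + C / δ * c) * Real.exp (lam * τ) := by
  have hc : 0 ≤ c := by simpa using (norm_nonneg _).trans (hg 0 le_rfl)
  have hk : 0 < lam - α := by linarith
  have key := norm_sub_le_of_norm_deriv_le_exp (c := C * c * Real.exp (α * τ)) hk.ne' hτ
    (fun t ht => hasDerivAt_exp_sub_smul_apply τ (hx t ht.1)) (fun t ht => by
      calc ‖exp ((τ - t) • A) (g t)‖ ≤ ‖exp ((τ - t) • A)‖ * ‖g t‖ :=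
            ContinuousLinearMap.le_opNorm _ _
        _ ≤ (C * Real.exp (α * (τ - t))) * (c * Real.exp (lam * t)) := by
            gcongr
            · exact hA _ (by linarith [ht.2])
            · exact hg t ht.1
        _ = C * c * (Real.exp (α * (τ - t)) * Real.exp (lam * t)) := by ring
        _ = C * c * Real.exp (α * τ) * Real.exp ((lam - α) * t) := by
            rw [mul_assoc (C * c), ← Real.exp_add, ← Real.exp_add]; ring_nf)
  simp only [sub_self, sub_zero, exp_zero_smul_apply, mul_zero, Real.exp_zero] at key
  have h1 : ‖exp (τ • A) (x 0)‖ ≤ C * ‖x 0‖ * Real.exp (lam * τ) := by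
    calc ‖exp (τ • A) (x 0)‖ ≤ ‖exp (τ • A)‖ * ‖x 0‖ := ContinuousLinearMap.le_opNorm _ _
      _ ≤ C * Real.exp (lam * τ) * ‖x 0‖ := by
          gcongr
          refine (hA τ hτ).trans ?_
          gcongr
          linarith
      _ = _ := by ring
  have h2 : C * c * Real.exp (α * τ) / (lam - α) * (Real.exp ((lam - α) * τ) - 1)
      ≤ C / δ * c * Real.exp (lam * τ) := by
    calc C * c * Real.exp (α * τ) / (lam - α) * (Real.exp ((lam - α) * τ) - 1)
        ≤ C * c * Real.exp (α * τ) / δ * Real.exp ((lam - α) * τ) := by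
          gcongr
          · rw [sub_nonneg]; exact Real.one_le_exp (by positivity)
          · linarith
          · linarith
      _ = C / δ * c * (Real.exp (α * τ) * Real.exp ((lam - α) * τ)) := by ring
      _ = _ := by rw [← Real.exp_add]; ring_nf
  calc ‖x τ‖ = ‖exp (τ • A) (x 0) + (x τ - exp (τ • A) (x 0))‖ := by congr 1; abel
    _ ≤ _ := norm_add_le _ _
    _ ≤ _ := by rw [add_mul]; exact add_le_add h1 (key.trans h2)

/-- Integrated form, between `τ` and `T`, of the equation `y' = -B y + g` for a stable `B`. -/
theorem norm_exp_sub_le_of_forced {B : V →L[ℝ] V} {C β lam δ c : ℝ}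
    (hB : ∀ t, 0 ≤ t → ‖exp (t • B)‖ ≤ C * Real.exp (-β * t)) (hC : 0 ≤ C) (hδ : 0 < δ)
    (hlam : lam + δ ≤ β) {y g : ℝ → V}
    (hy : ∀ t, 0 ≤ t → HasDerivAt y (-B (y t) + g t) t)
    (hg : ∀ t, 0 ≤ t → ‖g t‖ ≤ c * Real.exp (lam * t)) {τ T : ℝ} (hτ : 0 ≤ τ) (hT : τ ≤ T) :
    ‖exp ((T - τ) • B) (y T) - y τ‖ ≤ C / δ * c * Real.exp (lam * τ) := by
  have hc : 0 ≤ c := by simpa using (norm_nonneg _).trans (hg 0 le_rfl)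
  have hk : lam - β < 0 := by linarith
  have hneg : ∀ t : ℝ, (τ - t) • (-B) = (t - τ) • B := fun t => by
    rw [smul_neg, ← neg_smul, neg_sub]
  have key := norm_sub_le_of_norm_deriv_le_exp (c := C * c * Real.exp (β * τ)) hk.ne hT
    (fun t ht => hasDerivAt_exp_sub_smul_apply (L := -B) τ
      (by simpa using hy t (hτ.trans ht.1))) (fun t ht => by
      calc ‖exp ((τ - t) • (-B)) (g t)‖ ≤ ‖exp ((t - τ) • B)‖ * ‖g t‖ := by
            rw [hneg]; exact ContinuousLinearMap.le_opNorm _ _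
        _ ≤ (C * Real.exp (-β * (t - τ))) * (c * Real.exp (lam * t)) := by
            gcongr
            · exact hB _ (by linarith [ht.1])
            · exact hg t (hτ.trans ht.1)
        _ = C * c * (Real.exp (-β * (t - τ)) * Real.exp (lam * t)) := by ring
        _ = C * c * Real.exp (β * τ) * Real.exp ((lam - β) * t) := by
            rw [mul_assoc (C * c), ← Real.exp_add, ← Real.exp_add]; ring_nf)
  simp only [hneg, sub_self, exp_zero_smul_apply] at key
  refine key.trans ?_
  calc C * c * Real.exp (β * τ) / (lam - β) *
        (Real.exp ((lam - β) * T) - Real.exp ((lam - β) * τ))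
      = C * c * Real.exp (β * τ) / (β - lam) *
        (Real.exp ((lam - β) * τ) - Real.exp ((lam - β) * T)) := by
        rw [← neg_sub β lam, div_neg]; ring
    _ ≤ C * c * Real.exp (β * τ) / δ * Real.exp ((lam - β) * τ) := by
        gcongr
        · rw [sub_nonneg]
          exact Real.exp_le_exp.2 (mul_le_mul_of_nonpos_left hT hk.le)
        · linarith
        · linarith [Real.exp_pos ((lam - β) * T)]
    _ = C / δ * c * (Real.exp (β * τ) * Real.exp ((lam - β) * τ)) := by ring
    _ = _ := by rw [← Real.exp_add]; ring_nf

/-- A priori bound for the slowly growing solution of `y' = -B y + g` for a stable `B`. -/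
theorem norm_le_of_forced_of_growth {B : V →L[ℝ] V} {C β lam δ c C₀ : ℝ}
    (hB : ∀ t, 0 ≤ t → ‖exp (t • B)‖ ≤ C * Real.exp (-β * t)) (hC : 0 ≤ C) (hδ : 0 < δ)
    (hlam : lam + δ ≤ β) {y g : ℝ → V}
    (hy : ∀ t, 0 ≤ t → HasDerivAt y (-B (y t) + g t) t)
    (hg : ∀ t, 0 ≤ t → ‖g t‖ ≤ c * Real.exp (lam * t))
    (hgr : ∀ t, 0 ≤ t → ‖y t‖ ≤ C₀ * Real.exp (lam * t)) {τ : ℝ} (hτ : 0 ≤ τ) :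
    ‖y τ‖ ≤ C / δ * c * Real.exp (lam * τ) := by
  have hlim : Tendsto (fun T => C / δ * c * Real.exp (lam * τ) +
      C * C₀ * Real.exp (β * τ) * Real.exp ((lam - β) * T)) atTop
      (𝓝 (C / δ * c * Real.exp (lam * τ) + C * C₀ * Real.exp (β * τ) * 0)) := by
    refine tendsto_const_nhds.add (Tendsto.const_mul _ ?_)
    exact Real.tendsto_exp_atBot.comp (tendsto_id.const_mul_atTop_of_neg (by linarith))
  rw [mul_zero, add_zero] at hlim
  refine ge_of_tendsto hlim ?_
  filter_upwards [eventually_ge_atTop τ] with T hT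
  have h1 := norm_exp_sub_le_of_forced hB hC hδ hlam hy hg hτ hT
  have h2 : ‖exp ((T - τ) • B) (y T)‖ ≤
      C * C₀ * Real.exp (β * τ) * Real.exp ((lam - β) * T) := by
    calc ‖exp ((T - τ) • B) (y T)‖ ≤ ‖exp ((T - τ) • B)‖ * ‖y T‖ :=
          ContinuousLinearMap.le_opNorm _ _
      _ ≤ (C * Real.exp (-β * (T - τ))) * (C₀ * Real.exp (lam * T)) := by
          gcongr
          · exact hB _ (by linarith)
          · exact hgr T (hτ.trans hT)
      _ = C * C₀ * (Real.exp (-β * (T - τ)) * Real.exp (lam * T)) := by ring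
      _ = _ := by rw [mul_assoc (C * C₀), ← Real.exp_add, ← Real.exp_add]; ring_nf
  calc ‖y τ‖ = ‖exp ((T - τ) • B) (y T) - (exp ((T - τ) • B) (y T) - y τ)‖ := by
        rw [sub_sub_cancel]
    _ ≤ ‖exp ((T - τ) • B) (y T)‖ + ‖exp ((T - τ) • B) (y T) - y τ‖ := norm_sub_le _ _
    _ ≤ _ := by linarith

theorem exists_slowly_growing_solution {B : V →L[ℝ] V} {C β lam δ c : ℝ}
    (hB : ∀ t, 0 ≤ t → ‖exp (t • B)‖ ≤ C * Real.exp (-β * t)) (hC : 0 ≤ C) (hδ : 0 < δ)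
    (hlam : lam + δ ≤ β) {g : ℝ → V} (hgc : Continuous g)
    (hg : ∀ t, 0 ≤ t → ‖g t‖ ≤ c * Real.exp (lam * t)) :
    ∃ y : ℝ → V, (∀ t, HasDerivAt y (-B (y t) + g t) t) ∧
      ∃ C₀, ∀ t, 0 ≤ t → ‖y t‖ ≤ C₀ * Real.exp (lam * t) := by
  have hcont : Continuous fun s : ℝ => exp (s • B) (g s) := (continuous_exp_smul B).clm_apply hgc
  have hint : MeasureTheory.IntegrableOn (fun s : ℝ => exp (s • B) (g s)) (Ioi 0) := by
    refine MeasureTheory.Integrable.mono'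
      ((integrableOn_exp_mul_Ioi (a := lam - β) (by linarith) 0).const_mul (C * c))
      hcont.aestronglyMeasurable ?_
    refine (MeasureTheory.ae_restrict_mem measurableSet_Ioi).mono fun s hs => ?_
    have hs' : (0 : ℝ) ≤ s := le_of_lt hs
    calc ‖exp (s • B) (g s)‖ ≤ ‖exp (s • B)‖ * ‖g s‖ := ContinuousLinearMap.le_opNorm _ _
      _ ≤ (C * Real.exp (-β * s)) * (c * Real.exp (lam * s)) := by
          gcongr
          · exact hB _ hs'
          · exact hg s hs'
      _ = C * c * (Real.exp (-β * s) * Real.exp (lam * s)) := by ring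
      _ = _ := by rw [← Real.exp_add]; ring_nf
  obtain ⟨y, hy, hy'⟩ := exists_hasDerivAt_linear (-B) hgc
    (-∫ s in Ioi (0 : ℝ), exp (s • B) (g s))
  have hy'' : ∀ t, HasDerivAt y (-B (y t) + g t) t := fun t => by simpa using hy' t
  simp only [smul_neg, neg_smul, neg_neg] at hy
  have hlim := MeasureTheory.intervalIntegral_tendsto_integral_Ioi (0 : ℝ) hint tendsto_id
  have hzero : Tendsto (fun T => exp (T • B) (y T)) atTop (𝓝 0) := by
    have hEq : (fun T : ℝ => exp (T • B) (y T)) = fun T =>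
        -(∫ s in Ioi (0 : ℝ), exp (s • B) (g s)) + ∫ s in (0 : ℝ)..T, exp (s • B) (g s) := by
      funext T
      rw [hy, ← neg_smul, exp_smul_apply_exp_smul, add_neg_cancel, exp_zero_smul_apply]
    rw [hEq, ← neg_add_cancel (∫ s in Ioi (0 : ℝ), exp (s • B) (g s))]
    exact tendsto_const_nhds.add hlim
  refine ⟨y, hy'', C / δ * c, fun τ hτ => ?_⟩
  have hzero' : Tendsto (fun T => ‖exp ((T - τ) • B) (y T) - y τ‖) atTop (𝓝 ‖y τ‖) := by
    have h := (((exp ((-τ) • B)).continuous.tendsto 0).comp hzero).sub_const (y τ)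
    simp only [map_zero, zero_sub] at h
    have h' := h.norm
    rw [norm_neg] at h'
    refine h'.congr fun T => ?_
    rw [Function.comp_apply, exp_smul_apply_exp_smul, neg_add_eq_sub]
  refine le_of_tendsto hzero' ?_
  filter_upwards [eventually_ge_atTop τ] with T hT
  exact norm_exp_sub_le_of_forced hB hC hδ hlam (fun t _ => hy'' t) hg hτ hT

end LinearFlow

section Growth

variable {E : Type*} [NormedAddCommGroup E]

/-- `u` grows at most like `exp (lam * t)` for nonnegative times. -/
def HasGrowth (lam : ℝ) (u : ℝ → E) : Prop :=
  ∃ C₀, ∀ t, 0 ≤ t → ‖u t‖ ≤ C₀ * Real.exp (lam * t)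

variable {lam : ℝ} {u u' : ℝ → E}

theorem HasGrowth.sub (h : HasGrowth lam u) (h' : HasGrowth lam u') :
    HasGrowth lam (u - u') := by
  obtain ⟨c, hc⟩ := h
  obtain ⟨c', hc'⟩ := h'
  refine ⟨c + c', fun t ht => (norm_sub_le _ _).trans ?_⟩
  rw [add_mul]
  exact add_le_add (hc t ht) (hc' t ht)

theorem HasGrowth.add (h : HasGrowth lam u) (h' : HasGrowth lam u') :
    HasGrowth lam (u + u') := by
  obtain ⟨c, hc⟩ := h
  obtain ⟨c', hc'⟩ := h'
  refine ⟨c + c', fun t ht => (norm_add_le _ _).trans ?_⟩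
  rw [add_mul]
  exact add_le_add (hc t ht) (hc' t ht)

theorem HasGrowth.mono {lam' : ℝ} (h : HasGrowth lam u) (hle : lam ≤ lam') :
    HasGrowth lam' u := by
  obtain ⟨c, hc⟩ := h
  refine ⟨c, fun t ht => (hc t ht).trans ?_⟩
  have : 0 ≤ c := by simpa using (norm_nonneg _).trans (hc 0 le_rfl)
  gcongr

theorem HasGrowth.comp_const_add (h : HasGrowth lam u) {s : ℝ} (hs : 0 ≤ s) :
    HasGrowth lam fun t => u (s + t) := by
  obtain ⟨c, hc⟩ := h
  refine ⟨c * Real.exp (lam * s), fun t ht => (hc (s + t) (by positivity)).trans_eq ?_⟩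
  rw [mul_assoc, ← Real.exp_add, mul_add]

theorem HasGrowth.const_smul [NormedSpace ℝ E] (h : HasGrowth lam u) (a : ℝ) : HasGrowth lam (a • u) := by
  obtain ⟨c, hc⟩ := h
  refine ⟨|a| * c, fun t ht => ?_⟩
  rw [Pi.smul_apply, norm_smul, Real.norm_eq_abs, mul_assoc]
  exact mul_le_mul_of_nonneg_left (hc t ht) (abs_nonneg a)

end Growth

section SplitSystem

variable {X Y : Type*} [NormedAddCommGroup X] [NormedSpace ℝ X] [NormedAddCommGroup Y]
  [NormedSpace ℝ Y]

/-- Exponential bounds, with constant `C` and gap `δ`, for the flows of `A` (slowly growing)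
and `B` (decaying). -/
structure HasSplitBounds (A : X →L[ℝ] X) (B : Y →L[ℝ] Y) (C δ : ℝ) : Prop where
  nonneg : 0 ≤ C
  pos : 0 < δ
  norm_exp_left : ∀ t, 0 ≤ t → ‖exp (t • A)‖ ≤ C * Real.exp (δ * t)
  norm_exp_right : ∀ t, 0 ≤ t → ‖exp (t • B)‖ ≤ C * Real.exp (-(5 * δ) * t)

/-- `u` solves `x' = A x + r₁`, `y' = -B y + r₂` for nonnegative times. -/
def IsForcedSolution (A : X →L[ℝ] X) (B : Y →L[ℝ] Y) (r u : ℝ → X × Y) : Prop :=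
  ∀ t, 0 ≤ t → HasDerivAt u (A (u t).1 + (r t).1, -B (u t).2 + (r t).2) t

variable {A : X →L[ℝ] X} {B : Y →L[ℝ] Y} {C δ lam : ℝ} {r r' u u' : ℝ → X × Y}

theorem IsForcedSolution.fst (h : IsForcedSolution A B r u) (t : ℝ) (ht : 0 ≤ t) :
    HasDerivAt (fun t => (u t).1) (A (u t).1 + (r t).1) t :=
  (ContinuousLinearMap.fst ℝ X Y).hasFDerivAt.comp_hasDerivAt t (h t ht)

theorem IsForcedSolution.snd (h : IsForcedSolution A B r u) (t : ℝ) (ht : 0 ≤ t) :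
    HasDerivAt (fun t => (u t).2) (-B (u t).2 + (r t).2) t :=
  (ContinuousLinearMap.snd ℝ X Y).hasFDerivAt.comp_hasDerivAt t (h t ht)

theorem IsForcedSolution.sub (h : IsForcedSolution A B r u) (h' : IsForcedSolution A B r' u') :
    IsForcedSolution A B (r - r') (u - u') := fun t ht => by
  refine ((h t ht).sub (h' t ht)).congr_deriv ?_
  ext1 <;> simp <;> abel

theorem IsForcedSolution.add (h : IsForcedSolution A B r u) (h' : IsForcedSolution A B r' u') :
    IsForcedSolution A B (r + r') (u + u') := fun t ht => by
  refine ((h t ht).add (h' t ht)).congr_deriv ?_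
  ext1 <;> simp <;> abel

theorem IsForcedSolution.const_smul (h : IsForcedSolution A B r u) (a : ℝ) :
    IsForcedSolution A B (a • r) (a • u) := fun t ht => by
  refine ((h t ht).const_smul a).congr_deriv ?_
  ext1 <;> simp

theorem IsForcedSolution.congr (h : IsForcedSolution A B r u) (hr : ∀ t, 0 ≤ t → r t = r' t) :
    IsForcedSolution A B r' u := fun t ht => by
  rw [← hr t ht]; exact h t ht

variable [CompleteSpace Y]

theorem IsForcedSolution.norm_snd_le (hu : IsForcedSolution A B r u)
    (hAB : HasSplitBounds A B C δ) (hlam : lam ≤ 4 * δ)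
    (hgr : HasGrowth lam u) {c : ℝ} (hr : ∀ t, 0 ≤ t → ‖r t‖ ≤ c * Real.exp (lam * t))
    {τ : ℝ} (hτ : 0 ≤ τ) : ‖(u τ).2‖ ≤ C / δ * c * Real.exp (lam * τ) := by
  obtain ⟨C₀, hC₀⟩ := hgr
  exact norm_le_of_forced_of_growth hAB.norm_exp_right hAB.nonneg hAB.pos (by linarith) hu.snd
    (fun t ht => (_root_.norm_snd_le _).trans (hr t ht))
    (fun t ht => (_root_.norm_snd_le _).trans (hC₀ t ht)) hτ

variable [CompleteSpace X]

theorem IsForcedSolution.norm_le (hu : IsForcedSolution A B r u)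
    (hAB : HasSplitBounds A B C δ) (hlam : 2 * δ ≤ lam) (hlam' : lam ≤ 4 * δ)
    (hgr : HasGrowth lam u) {c : ℝ} (hr : ∀ t, 0 ≤ t → ‖r t‖ ≤ c * Real.exp (lam * t))
    {τ : ℝ} (hτ : 0 ≤ τ) :
    ‖u τ‖ ≤ (C * ‖(u 0).1‖ + C / δ * c) * Real.exp (lam * τ) := by
  refine norm_prod_le_iff.2 ⟨?_, ?_⟩
  · exact norm_le_of_forced hAB.norm_exp_left hAB.nonneg hAB.pos (by linarith) hu.fst
      (fun t ht => (norm_fst_le _).trans (hr t ht)) hτ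
  · refine (hu.norm_snd_le hAB hlam' hgr hr hτ).trans ?_
    have := hAB.nonneg
    gcongr
    exact le_add_of_nonneg_left (by positivity)

/-- A priori bound for solutions of a system whose nonlinearity is small against the gap. -/
theorem IsForcedSolution.norm_le_of_small (hu : IsForcedSolution A B r u)
    (hAB : HasSplitBounds A B C δ) (hlam : 2 * δ ≤ lam) (hlam' : lam ≤ 4 * δ)
    (hgr : HasGrowth lam u) {ε c : ℝ} (hε : 0 ≤ ε) (hsmall : C / δ * ε ≤ 1 / 2)
    (hr : ∀ t, 0 ≤ t → ‖r t‖ ≤ ε * ‖u t‖ + c * Real.exp (lam * t)) {τ : ℝ} (hτ : 0 ≤ τ) :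
    ‖u τ‖ ≤ 2 * (C * ‖(u 0).1‖ + C / δ * c) * Real.exp (lam * τ) := by
  have hgr' := hgr
  obtain ⟨C₀, hC₀⟩ := hgr'
  set S : Set ℝ := (fun t => ‖u t‖ * Real.exp (-(lam * t))) '' Ici 0 with hS
  have hbdd : BddAbove S := by
    refine ⟨C₀, ?_⟩
    rintro _ ⟨t, ht, rfl⟩
    calc ‖u t‖ * Real.exp (-(lam * t)) ≤ C₀ * Real.exp (lam * t) * Real.exp (-(lam * t)) := by
          gcongr; exact hC₀ t ht
      _ = C₀ := by rw [mul_assoc, ← Real.exp_add]; simp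
  have hle : ∀ t, 0 ≤ t → ‖u t‖ ≤ sSup S * Real.exp (lam * t) := fun t ht => by
    have h : ‖u t‖ * Real.exp (-(lam * t)) ≤ sSup S := le_csSup hbdd ⟨t, ht, rfl⟩
    calc ‖u t‖ = ‖u t‖ * Real.exp (-(lam * t)) * Real.exp (lam * t) := by
          rw [mul_assoc, ← Real.exp_add]; simp
      _ ≤ _ := by gcongr
  have hN : 0 ≤ sSup S := by simpa using (norm_nonneg _).trans (hle 0 le_rfl)
  have key : ∀ t, 0 ≤ t →
      ‖u t‖ ≤ (C * ‖(u 0).1‖ + C / δ * (ε * sSup S + c)) * Real.exp (lam * t) := fun t ht =>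
    hu.norm_le hAB hlam hlam' hgr (fun s hs => by
      refine (hr s hs).trans ?_
      rw [add_mul, mul_assoc]
      gcongr
      exact hle s hs) ht
  have hsup : sSup S ≤ C * ‖(u 0).1‖ + C / δ * (ε * sSup S + c) := by
    refine csSup_le ⟨_, 0, self_mem_Ici, rfl⟩ ?_
    rintro _ ⟨t, ht, rfl⟩
    calc ‖u t‖ * Real.exp (-(lam * t))
        ≤ (C * ‖(u 0).1‖ + C / δ * (ε * sSup S + c)) * Real.exp (lam * t) *
          Real.exp (-(lam * t)) := by gcongr; exact key t ht
      _ = _ := by rw [mul_assoc, ← Real.exp_add]; simp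
  refine (hle τ hτ).trans ?_
  gcongr
  have h := mul_le_mul_of_nonneg_right hsmall hN
  nlinarith

theorem exists_isForcedSolution (hAB : HasSplitBounds A B C δ) (hlam : 2 * δ ≤ lam)
    (hlam' : lam ≤ 4 * δ) {g : ℝ → X × Y} (hgc : Continuous g) (hg : HasGrowth lam g) (ξ : X) :
    ∃ u : ℝ → X × Y, Continuous u ∧ IsForcedSolution A B g u ∧ (u 0).1 = ξ ∧
      HasGrowth lam u := by
  obtain ⟨c, hc⟩ := hg
  obtain ⟨x, hx, hx'⟩ := exists_hasDerivAt_linear A (continuous_fst.comp hgc) ξ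
  obtain ⟨y, hy', C₀, hC₀⟩ := exists_slowly_growing_solution hAB.norm_exp_right hAB.nonneg
    hAB.pos (by linarith) (continuous_snd.comp hgc)
    (fun t ht => (norm_snd_le _).trans (hc t ht))
  have hx0 : x 0 = ξ := by rw [hx]; simp
  refine ⟨fun t => (x t, y t), ?_, fun t _ => (hx' t).prodMk (hy' t), hx0,
    max (C * ‖x 0‖ + C / δ * c) C₀, fun t ht => norm_prod_le_iff.2 ⟨?_, ?_⟩⟩
  · exact continuous_iff_continuousAt.2 fun t => (hx' t).continuousAt.prodMk (hy' t).continuousAt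
  · refine (norm_le_of_forced hAB.norm_exp_left hAB.nonneg hAB.pos (by linarith)
      (fun t _ => hx' t) (fun t ht => (norm_fst_le _).trans (hc t ht)) ht).trans ?_
    gcongr
    exact le_max_left _ _
  · refine (hC₀ t ht).trans ?_
    gcongr
    exact le_max_right _ _

/-- Existence of slowly growing solutions of a semilinear system whose nonlinearity is small
against the gap. -/
theorem exists_isForcedSolution_semilinear (hAB : HasSplitBounds A B C δ)
    {G : ℝ → X × Y → X × Y} (hGc : Continuous fun p : ℝ × (X × Y) => G p.1 p.2) {ε : ℝ}
    (hε : 0 ≤ ε) (hsmall : C / δ * ε ≤ 1 / 2) (hG0 : ∀ t, G t 0 = 0)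
    (hG : ∀ t p q, ‖G t p - G t q‖ ≤ ε * ‖p - q‖) (ξ : X) :
    ∃ u : ℝ → X × Y, Continuous u ∧ IsForcedSolution A B (fun t => G t (u t)) u ∧
      (u 0).1 = ξ ∧ HasGrowth (2 * δ) u := by
  have hδ := hAB.pos
  let g : BoundedContinuousFunction ℝ (X × Y) → ℝ → X × Y :=
    fun φ t => G t (Real.exp (2 * δ * t) • φ t)
  have hgc : ∀ φ, Continuous (g φ) := fun φ =>
    hGc.comp (continuous_id.prodMk ((by fun_prop : Continuous fun t => Real.exp (2 * δ * t)).smul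
      φ.continuous))
  have hgr : ∀ φ, HasGrowth (2 * δ) (g φ) := fun φ => ⟨ε * ‖φ‖, fun t _ => by
    have h := hG t (Real.exp (2 * δ * t) • φ t) 0
    rw [hG0, sub_zero, sub_zero, norm_smul, Real.norm_eq_abs, Real.abs_exp] at h
    refine h.trans ?_
    rw [mul_assoc ε, mul_comm ‖φ‖]
    gcongr
    exact φ.norm_coe_le_norm t⟩
  choose U hUc hU hU0 hUg using fun φ =>
    exists_isForcedSolution (lam := 2 * δ) hAB le_rfl (by linarith) (hgc φ) (hgr φ) ξ
  choose M hM using hUg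
  let T : BoundedContinuousFunction ℝ (X × Y) → BoundedContinuousFunction ℝ (X × Y) := fun φ =>
    BoundedContinuousFunction.ofNormedAddCommGroup
      (fun t => Real.exp (-(2 * δ * max t 0)) • U φ (max t 0))
      ((by fun_prop : Continuous fun t : ℝ => Real.exp (-(2 * δ * max t 0))).smul
        ((hUc φ).comp (by fun_prop))) (M φ) (fun t => by
        rw [norm_smul, Real.norm_eq_abs, Real.abs_exp]
        calc Real.exp (-(2 * δ * max t 0)) * ‖U φ (max t 0)‖
            ≤ Real.exp (-(2 * δ * max t 0)) * (M φ * Real.exp (2 * δ * max t 0)) := by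
              gcongr; exact hM φ _ (le_max_right _ _)
          _ = M φ := by rw [mul_left_comm, ← Real.exp_add]; simp)
  have hT : ContractingWith (1 / 2) T := by
    refine ⟨by norm_num, LipschitzWith.of_dist_le_mul fun φ ψ => ?_⟩
    refine (BoundedContinuousFunction.dist_le (by positivity)).2 fun t => ?_
    have h := ((hU φ).sub (hU ψ)).norm_le (c := ε * dist φ ψ) hAB le_rfl (by linarith)
      (HasGrowth.sub ⟨_, hM φ⟩ ⟨_, hM ψ⟩) (fun s _ => by
        refine (hG s _ _).trans ?_
        rw [← smul_sub, norm_smul, Real.norm_eq_abs, Real.abs_exp, mul_assoc ε,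
          mul_comm (dist φ ψ), ← dist_eq_norm]
        gcongr
        exact BoundedContinuousFunction.dist_coe_le_dist s) (le_max_right t 0)
    rw [Pi.sub_apply _ _ 0, Prod.fst_sub, hU0, hU0, sub_self, norm_zero, mul_zero, zero_add] at h
    calc dist (T φ t) (T ψ t)
        = Real.exp (-(2 * δ * max t 0)) * ‖(U φ - U ψ) (max t 0)‖ := by
          rw [dist_eq_norm]
          change ‖Real.exp (-(2 * δ * max t 0)) • U φ (max t 0) -
            Real.exp (-(2 * δ * max t 0)) • U ψ (max t 0)‖ = _
          rw [← smul_sub, norm_smul, Real.norm_eq_abs, Real.abs_exp, Pi.sub_apply]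
      _ ≤ Real.exp (-(2 * δ * max t 0)) *
          (C / δ * (ε * dist φ ψ) * Real.exp (2 * δ * max t 0)) := by gcongr
      _ = C / δ * ε * dist φ ψ := by
          rw [mul_left_comm, ← Real.exp_add, ← mul_assoc (C / δ)]; simp
      _ ≤ ((1 / 2 : NNReal) : ℝ) * dist φ ψ := by
          gcongr
          simpa using hsmall
  obtain ⟨φ, hφ⟩ : ∃ φ, T φ = φ := ⟨_, hT.fixedPoint_isFixedPt⟩
  have hval : ∀ t, 0 ≤ t → Real.exp (2 * δ * t) • φ t = U φ t := fun t ht => by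
    have h : Real.exp (-(2 * δ * max t 0)) • U φ (max t 0) = φ t := DFunLike.congr_fun hφ t
    rw [max_eq_left ht] at h
    rw [← h, smul_smul, ← Real.exp_add, add_neg_cancel, Real.exp_zero, one_smul]
  exact ⟨U φ, hUc φ, (hU φ).congr fun t ht => by simp only [g, hval t ht], hU0 φ, _, hM φ⟩

/-- Slowly growing solutions depend Lipschitz continuously on their first initial component. -/
theorem norm_sub_le_of_isForcedSolution (hAB : HasSplitBounds A B C δ)
    {ε : ℝ} (hε : 0 ≤ ε) (hsmall : C / δ * ε ≤ 1 / 2) {G : ℝ → X × Y → X × Y}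
    (hG : ∀ t p q, ‖G t p - G t q‖ ≤ ε * ‖p - q‖) {u v : ℝ → X × Y}
    (hu : IsForcedSolution A B (fun t => G t (u t)) u) (hug : HasGrowth (2 * δ) u)
    (hv : IsForcedSolution A B (fun t => G t (v t)) v) (hvg : HasGrowth (2 * δ) v)
    {τ : ℝ} (hτ : 0 ≤ τ) :
    ‖u τ - v τ‖ ≤ 2 * C * ‖(u 0).1 - (v 0).1‖ * Real.exp (2 * δ * τ) := by
  have h := (hu.sub hv).norm_le_of_small hAB le_rfl (by linarith [hAB.pos]) (hug.sub hvg)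
    (c := 0) hε hsmall (fun t _ => by simpa using hG t (u t) (v t)) hτ
  simpa [mul_assoc] using h

end SplitSystem

section QuadraticApproximation

variable {E F : Type*} [NormedAddCommGroup E] [NormedSpace ℝ E] [NormedAddCommGroup F]
  [NormedSpace ℝ F]

theorem hasFDerivAt_of_norm_sub_le_sq {h : E → F} {D : E →L[ℝ] F} {M : ℝ} {x : E}
    (hD : ∀ k, ‖h (x + k) - h x - D k‖ ≤ M * ‖k‖ ^ 2) : HasFDerivAt h D x := by
  rw [hasFDerivAt_iff_isLittleO_nhds_zero]
  refine (Asymptotics.IsBigO.of_bound M (.of_forall fun k => ?_)).trans_isLittleO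
    (Asymptotics.isLittleO_norm_pow_id one_lt_two)
  simpa using hD k

/-- A map with a first order expansion whose remainder is uniformly quadratic is `C^1`. -/
theorem contDiff_one_of_norm_sub_le_sq {h : E → F} {D : E → E →L[ℝ] F} {M : ℝ}
    (hD : ∀ x k, ‖h (x + k) - h x - D x k‖ ≤ M * ‖k‖ ^ 2) : ContDiff ℝ 1 h := by
  have hder : ∀ x, HasFDerivAt h (D x) x := fun x => hasFDerivAt_of_norm_sub_le_sq (hD x)
  have hfd : fderiv ℝ h = D := funext fun x => (hder x).fderiv
  refine contDiff_one_iff_fderiv.2 ⟨fun x => (hder x).differentiableAt, ?_⟩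
  rw [hfd]
  rcases subsingleton_or_nontrivial E with hE | hE
  · exact continuous_of_const fun x y => by rw [Subsingleton.elim x y]
  have hM : 0 ≤ M := by
    obtain ⟨k, hk⟩ := exists_ne (0 : E)
    have h0 := (norm_nonneg _).trans (hD 0 k)
    exact nonneg_of_mul_nonneg_left h0 (by positivity)
  have heq : ∀ x k l, ‖l‖ = ‖k‖ → ‖(D (x + k) - D x) l‖ ≤ 6 * M * ‖k‖ * ‖l‖ := by
    intro x k l hl
    have h1 := hD (x + k) l
    have h2 := hD x (k + l)
    have h3 := hD x k
    have hkl : ‖k + l‖ ≤ 2 * ‖k‖ := by linarith [norm_add_le k l]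
    have hsq : M * ‖k + l‖ ^ 2 ≤ M * (2 * ‖k‖) ^ 2 := by gcongr
    rw [hl] at h1
    have hid : (D (x + k) - D x) l = (h (x + (k + l)) - h x - D x (k + l))
        - (h (x + k + l) - h (x + k) - D (x + k) l) - (h (x + k) - h x - D x k) := by
      rw [sub_apply, map_add, add_assoc]; abel
    rw [hid, hl]
    calc _ ≤ ‖h (x + (k + l)) - h x - D x (k + l)‖ +
          ‖h (x + k + l) - h (x + k) - D (x + k) l‖ + ‖h (x + k) - h x - D x k‖ :=
          (norm_sub_le _ _).trans (add_le_add_left (norm_sub_le _ _) _)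
      _ ≤ _ := by nlinarith
  have hlip : ∀ x k, ‖D (x + k) - D x‖ ≤ 6 * M * ‖k‖ := by
    intro x k
    rcases eq_or_ne k 0 with rfl | hk
    · simp
    refine ContinuousLinearMap.opNorm_le_bound _ (by positivity) fun l => ?_
    rcases eq_or_ne l 0 with rfl | hl
    · simp
    have hk' := norm_pos_iff.2 hk
    have hl' := norm_pos_iff.2 hl
    have hs := heq x k ((‖k‖ / ‖l‖) • l) (by
      rw [norm_smul, Real.norm_of_nonneg (by positivity), div_mul_cancel₀ _ hl'.ne'])
    rw [map_smul, norm_smul, norm_smul, Real.norm_of_nonneg (by positivity), mul_left_comm] at hs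
    exact le_of_mul_le_mul_left hs (by positivity)
  refine (LipschitzWith.of_dist_le_mul (K := ⟨6 * M, by positivity⟩) fun x y => ?_).continuous
  have := hlip y (x - y)
  rwa [add_sub_cancel, ← dist_eq_norm, ← dist_eq_norm] at this

theorem norm_sub_sub_fderiv_le_sq {f : E → F} (hf : Differentiable ℝ f) {K : ℝ} (hK : 0 ≤ K)
    (hLip : ∀ p q, ‖fderiv ℝ f p - fderiv ℝ f q‖ ≤ K * ‖p - q‖) (p q : E) :
    ‖f q - f p - fderiv ℝ f p (q - p)‖ ≤ K * ‖q - p‖ ^ 2 := by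
  rw [sq, ← mul_assoc]
  refine (convex_closedBall p ‖q - p‖).norm_image_sub_le_of_norm_fderiv_le' (𝕜 := ℝ)
    (fun z _ => hf z) (fun z hz => (hLip z p).trans ?_)
    (Metric.mem_closedBall_self (norm_nonneg _)) (by simp [dist_eq_norm])
  gcongr
  simpa [dist_eq_norm] using hz

end QuadraticApproximation

section InvariantGraph

variable {X Y : Type*} [NormedAddCommGroup X] [NormedSpace ℝ X] [FiniteDimensional ℝ X]
  [NormedAddCommGroup Y] [NormedSpace ℝ Y] [CompleteSpace Y]
  {A : X →L[ℝ] X} {B : Y →L[ℝ] Y} {C δ ε : ℝ}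

/-- Global invariant graph for a system with a globally small nonlinearity. -/
theorem exists_global_invariant_graph (hAB : HasSplitBounds A B C δ) (hε : 0 ≤ ε)
    (hsmall : C / δ * ε ≤ 1 / 2) {f : X × Y → X × Y} (hf : Differentiable ℝ f)
    (hfε : ∀ p, ‖fderiv ℝ f p‖ ≤ ε) {K : ℝ} (hK : 0 ≤ K)
    (hfK : ∀ p q, ‖fderiv ℝ f p - fderiv ℝ f q‖ ≤ K * ‖p - q‖) (hf0 : f 0 = 0)
    (hDf0 : fderiv ℝ f 0 = 0) :
    ∃ h : X → Y, ContDiff ℝ 1 h ∧ h 0 = 0 ∧ fderiv ℝ h 0 = 0 ∧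
      ∀ x, fderiv ℝ h x (A x + (f (x, h x)).1) = -B (h x) + (f (x, h x)).2 := by
  have : CompleteSpace X := FiniteDimensional.complete ℝ X
  have hδ := hAB.pos
  have hC := hAB.nonneg
  have hflip : ∀ p q, ‖f p - f q‖ ≤ ε * ‖p - q‖ := fun p q =>
    convex_univ.norm_image_sub_le_of_norm_fderiv_le (𝕜 := ℝ) (fun z _ => hf z)
      (fun z _ => hfε z) (mem_univ q) (mem_univ p)
  have hDfc : Continuous (fderiv ℝ f) :=
    (LipschitzWith.of_dist_le_mul (K := ⟨K, hK⟩) fun p q => by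
      rw [dist_eq_norm, dist_eq_norm]; exact hfK p q).continuous
  choose u huc hu hu0 hug using exists_isForcedSolution_semilinear hAB
    (G := fun _ p => f p) (hf.continuous.comp continuous_snd) hε hsmall (fun _ => hf0)
    (fun _ => hflip)
  have hdlip : ∀ ξ t p q,
      ‖fderiv ℝ f (u ξ t) p - fderiv ℝ f (u ξ t) q‖ ≤ ε * ‖p - q‖ := fun ξ t p q => by
    rw [← map_sub]
    exact ContinuousLinearMap.le_of_opNorm_le _ (hfε _) _
  choose v hvc hv hv0 hvg using fun ξ => exists_isForcedSolution_semilinear hAB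
    (G := fun t p => fderiv ℝ f (u ξ t) p)
    ((hDfc.comp ((huc ξ).comp continuous_fst)).clm_apply continuous_snd) hε hsmall
    (fun _ => map_zero _) (hdlip ξ)
  have hvuniq : ∀ ξ (w w' : ℝ → X × Y),
      IsForcedSolution A B (fun t => fderiv ℝ f (u ξ t) (w t)) w → HasGrowth (2 * δ) w →
      IsForcedSolution A B (fun t => fderiv ℝ f (u ξ t) (w' t)) w' → HasGrowth (2 * δ) w' →
      (w 0).1 = (w' 0).1 → w 0 = w' 0 := fun ξ w w' hw hwg hw' hwg' h0 => by
    have h := norm_sub_le_of_isForcedSolution hAB hε hsmall (hdlip ξ) hw hwg hw' hwg' le_rfl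
    rw [h0, sub_self, norm_zero, mul_zero, zero_mul] at h
    exact sub_eq_zero.1 (norm_le_zero_iff.1 h)
  let D : X → X →L[ℝ] Y := fun ξ => LinearMap.toContinuousLinearMap
    { toFun := fun k => (v ξ k 0).2
      map_add' := fun k l => by
        rw [← Prod.snd_add]
        refine congrArg Prod.snd (hvuniq ξ _ (v ξ k + v ξ l) (hv ξ _) (hvg ξ _)
          (((hv ξ k).add (hv ξ l)).congr fun t _ => ?_) ((hvg ξ k).add (hvg ξ l)) ?_)
        · simp
        · simp [hv0]
      map_smul' := fun a k => by
        rw [RingHom.id_apply, ← Prod.smul_snd]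
        refine congrArg Prod.snd (hvuniq ξ _ (a • v ξ k) (hv ξ _) (hvg ξ _)
          (((hv ξ k).const_smul a).congr fun t _ => ?_) ((hvg ξ k).const_smul a) ?_)
        · simp
        · simp [hv0] }
  have hDv : ∀ ξ k, D ξ k = (v ξ k 0).2 := fun _ _ => rfl
  have hquad : ∀ ξ k, ‖(u (ξ + k) 0).2 - (u ξ 0).2 - D ξ k‖ ≤
      2 * (C / δ * (K * (2 * C) ^ 2)) * ‖k‖ ^ 2 := by
    intro ξ k
    have hw := (((hu (ξ + k)).sub (hu ξ)).sub (hv ξ k)).norm_le_of_small hAB (lam := 4 * δ)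
      (by linarith) le_rfl
      ((((hug (ξ + k)).sub (hug ξ)).sub (hvg ξ k)).mono (by linarith)) hε hsmall
      (c := K * (2 * C * ‖k‖) ^ 2) (fun t ht => ?_) le_rfl
    · have h0 : ((u (ξ + k) - u ξ - v ξ k) 0).1 = 0 := by simp [hu0, hv0]
      rw [h0, norm_zero, mul_zero, zero_add, mul_zero, Real.exp_zero, mul_one] at hw
      refine ((norm_snd_le _).trans hw).trans_eq ?_
      ring
    · have hd := norm_sub_le_of_isForcedSolution hAB hε hsmall (fun _ => hflip) (hu (ξ + k))
        (hug _) (hu ξ) (hug _) ht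
      rw [hu0, hu0, add_sub_cancel_left] at hd
      have hq := norm_sub_sub_fderiv_le_sq hf hK hfK (u ξ t) (u (ξ + k) t)
      have hl : ‖fderiv ℝ f (u ξ t) (u (ξ + k) t - u ξ t - v ξ k t)‖ ≤
          ε * ‖u (ξ + k) t - u ξ t - v ξ k t‖ :=
        ContinuousLinearMap.le_of_opNorm_le _ (hfε _) _
      have hid : f (u (ξ + k) t) - f (u ξ t) - fderiv ℝ f (u ξ t) (v ξ k t) =
          fderiv ℝ f (u ξ t) (u (ξ + k) t - u ξ t - v ξ k t) +
          (f (u (ξ + k) t) - f (u ξ t) - fderiv ℝ f (u ξ t) (u (ξ + k) t - u ξ t)) := by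
        rw [map_sub _ (u (ξ + k) t - u ξ t)]; abel
      change ‖f (u (ξ + k) t) - f (u ξ t) - fderiv ℝ f (u ξ t) (v ξ k t)‖ ≤
        ε * ‖u (ξ + k) t - u ξ t - v ξ k t‖ + _
      rw [hid]
      refine (norm_add_le _ _).trans (add_le_add hl (hq.trans ?_))
      calc K * ‖u (ξ + k) t - u ξ t‖ ^ 2
          ≤ K * (2 * C * ‖k‖ * Real.exp (2 * δ * t)) ^ 2 := by gcongr
        _ = K * (2 * C * ‖k‖) ^ 2 * Real.exp (4 * δ * t) := by
          rw [mul_pow _ (Real.exp _), ← Real.exp_nat_mul, ← mul_assoc]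
          congr 2
          push_cast
          ring
  have hder : ∀ ξ, HasFDerivAt (fun ξ => (u ξ 0).2) (D ξ) ξ := fun ξ =>
    hasFDerivAt_of_norm_sub_le_sq (hquad ξ)
  have hgraph : ∀ ξ, u ξ 0 = (ξ, (u ξ 0).2) := fun ξ => Prod.ext (hu0 ξ) rfl
  have huzero : ∀ t, 0 ≤ t → u 0 t = 0 := fun t ht => by
    have hz : IsForcedSolution A B (fun t => f ((0 : ℝ → X × Y) t)) 0 := fun t _ => by
      refine (hasDerivAt_const t (0 : X × Y)).congr_deriv ?_
      ext1 <;> simp [hf0]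
    have h := norm_sub_le_of_isForcedSolution hAB hε hsmall (fun _ => hflip) (hu 0) (hug 0) hz
      ⟨0, by simp⟩ ht
    simpa [hu0] using h
  refine ⟨fun ξ => (u ξ 0).2, contDiff_one_of_norm_sub_le_sq hquad, ?_, ?_, fun ξ => ?_⟩
  · simp [huzero 0 le_rfl]
  · rw [(hder 0).fderiv]
    ext1 k
    have h := (hv 0 k).norm_snd_le hAB (lam := 2 * δ) (by linarith) (hvg 0 k) (c := 0)
      (fun t ht => by simp [huzero t ht, hDf0]) le_rfl
    simpa [hDv] using h
  · rw [(hder ξ).fderiv, ← hgraph]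
    have hinv : ∀ s, 0 ≤ s → (u ξ s).2 = (u (u ξ s).1 0).2 := fun s hs => by
      have hshift : IsForcedSolution A B (fun t => f (u ξ (s + t))) fun t => u ξ (s + t) :=
        fun t ht => (hu ξ (s + t) (by positivity)).comp_const_add s t
      have h := norm_sub_le_of_isForcedSolution hAB hε hsmall (fun _ => hflip) hshift
        ((hug ξ).comp_const_add hs) (hu (u ξ s).1) (hug _) le_rfl
      rw [add_zero, hu0, sub_self, norm_zero, mul_zero, zero_mul] at h
      exact congrArg Prod.snd (sub_eq_zero.1 (norm_le_zero_iff.1 h))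
    have h1 := ((hu ξ).snd 0 le_rfl).hasDerivWithinAt (s := Ici 0)
    have h2 : HasDerivWithinAt (fun s => (u (u ξ s).1 0).2)
        (D ξ (A (u ξ 0).1 + (f (u ξ 0)).1)) (Ici 0) 0 :=
      HasFDerivAt.comp_hasDerivWithinAt (l := fun ξ => (u ξ 0).2) 0 (by rw [hu0]; exact hder ξ)
        ((hu ξ).fst 0 le_rfl).hasDerivWithinAt
    have h3 := (uniqueDiffOn_Ici (0 : ℝ) 0 self_mem_Ici).eq_deriv _
      (h2.congr (fun s hs => hinv s hs) (hinv 0 le_rfl)) h1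
    rwa [hu0] at h3

end InvariantGraph

section SpectralBounds

/-- Growth of a curve satisfying `w' = μ w + g`. -/
theorem norm_le_of_hasDerivAt_smul_add {V : Type*} [NormedAddCommGroup V] [NormedSpace ℂ V]
    {w g : ℝ → V} {μ : ℂ} {γ c : ℝ} (hμ : μ.re < γ)
    (hw : ∀ t, HasDerivAt w (μ • w t + g t) t)
    (hg : ∀ t, 0 ≤ t → ‖g t‖ ≤ c * Real.exp (γ * t)) {τ : ℝ} (hτ : 0 ≤ τ) :
    ‖w τ‖ ≤ (‖w 0‖ + c / (γ - μ.re)) * Real.exp (γ * τ) := by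
  have hc : 0 ≤ c := by simpa using (norm_nonneg _).trans (hg 0 le_rfl)
  have hk : 0 < γ - μ.re := sub_pos.2 hμ
  have hnorm : ∀ t : ℝ, ‖Complex.exp (-μ * t)‖ = Real.exp (-μ.re * t) := fun t => by
    rw [Complex.norm_exp]; simp
  have hE : ∀ t : ℝ, HasDerivAt (fun t : ℝ => Complex.exp (-μ * t))
      (Complex.exp (-μ * t) * -μ) t := fun t => by
    have h := ((Complex.ofRealCLM.hasDerivAt (x := t)).const_mul (-μ)).cexp
    simpa using h
  have key := norm_sub_le_of_norm_deriv_le_exp (c := c) (k := γ - μ.re) hk.ne' hτ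
    (fun t _ => (hE t).smul (hw t)) (fun t ht => by
      have h : Complex.exp (-μ * t) • (μ • w t + g t) + (Complex.exp (-μ * t) * -μ) • w t =
          Complex.exp (-μ * t) • g t := by module
      rw [h, norm_smul, hnorm]
      calc Real.exp (-μ.re * t) * ‖g t‖ ≤ Real.exp (-μ.re * t) * (c * Real.exp (γ * t)) := by
            gcongr; exact hg t ht.1
        _ = c * Real.exp ((γ - μ.re) * t) := by
            rw [mul_left_comm, ← Real.exp_add]; ring_nf)
  have hb : ‖Complex.exp (-μ * τ) • w τ‖ ≤
      (‖w 0‖ + c / (γ - μ.re)) * Real.exp ((γ - μ.re) * τ) := by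
    have h0 : Complex.exp (-μ * (0 : ℝ)) • w 0 = w 0 := by simp
    have h1 : 1 ≤ Real.exp ((γ - μ.re) * τ) := Real.one_le_exp (by positivity)
    simp only [Pi.smul_apply', h0, mul_zero, Real.exp_zero] at key
    have h2 : 0 ≤ c / (γ - μ.re) := by positivity
    have h3 := norm_le_norm_add_norm_sub' (Complex.exp (-μ * τ) • w τ) (w 0)
    nlinarith [norm_nonneg (w 0)]
  rw [norm_smul, hnorm] at hb
  calc ‖w τ‖ = Real.exp (μ.re * τ) * (Real.exp (-μ.re * τ) * ‖w τ‖) := by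
        rw [← mul_assoc, ← Real.exp_add]; simp
    _ ≤ Real.exp (μ.re * τ) * ((‖w 0‖ + c / (γ - μ.re)) * Real.exp ((γ - μ.re) * τ)) := by gcongr
    _ = _ := by rw [mul_left_comm, ← Real.exp_add]; ring_nf

open Polynomial in
/-- A solution of `w' = M w` annihilated by a polynomial in `M` grows no faster than the roots of
that polynomial allow. -/
theorem hasGrowth_of_aeval_mulVec_eq_zero {n : ℕ} (M : Matrix (Fin n) (Fin n) ℂ) {γ : ℝ}
    (s : Multiset ℂ) (hs : ∀ μ ∈ s, μ.re < γ) (w : ℝ → Fin n → ℂ)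
    (hw : ∀ t, HasDerivAt w (M.mulVec (w t)) t)
    (h0 : ∀ t, (aeval M (s.map fun μ => X - C μ).prod).mulVec (w t) = 0) :
    HasGrowth γ w := by
  induction s using Multiset.induction_on generalizing w with
  | empty =>
    refine ⟨0, fun t _ => ?_⟩
    have h : w t = 0 := by simpa using h0 t
    simp [h]
  | cons μ s ih =>
    let N : Matrix (Fin n) (Fin n) ℂ := M - algebraMap ℂ _ μ
    have hN : aeval M (X - C μ) = N := by simp [N]
    have hcomm : Commute M N := (Commute.refl M).sub_right (Algebra.commutes μ M).symm
    obtain ⟨c, hc⟩ := ih (fun ν hν => hs ν (Multiset.mem_cons_of_mem hν))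
      (fun t => N.mulVec (w t))
      (fun t => by
        have h := ((N.mulVecLin.restrictScalars ℝ).toContinuousLinearMap.hasFDerivAt
          (x := w t)).comp_hasDerivAt t (hw t)
        refine h.congr_deriv ?_
        simp [Matrix.mulVec_mulVec, hcomm.eq])
      (fun t => by
        have h := h0 t
        rwa [Multiset.map_cons, Multiset.prod_cons, mul_comm, map_mul, hN,
          ← Matrix.mulVec_mulVec] at h)
    refine ⟨_, fun t ht => norm_le_of_hasDerivAt_smul_add (hs μ (Multiset.mem_cons_self μ s))
      (fun t => (hw t).congr_deriv ?_) hc ht⟩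
    simp [N, Matrix.sub_mulVec, Algebra.algebraMap_eq_smul_one, Matrix.smul_mulVec]

theorem exists_norm_exp_smul_le {n : ℕ} (F : Matrix (Fin n) (Fin n) ℝ) {γ : ℝ}
    (hF : ∀ μ : ℂ, (F.map (algebraMap ℝ ℂ)).charpoly.IsRoot μ → μ.re < γ) :
    ∃ C, ∀ t, 0 ≤ t →
      ‖exp (t • F.mulVecLin.toContinuousLinearMap)‖ ≤ C * Real.exp (γ * t) := by
  set L := F.mulVecLin.toContinuousLinearMap with hL
  set M := F.map (algebraMap ℝ ℂ) with hM
  have hpt : ∀ x : Fin n → ℝ, HasGrowth γ fun t => exp (t • L) x := fun x => by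
    let ι : (Fin n → ℝ) →L[ℝ] (Fin n → ℂ) :=
      ContinuousLinearMap.pi fun i => Complex.ofRealCLM.comp (ContinuousLinearMap.proj i)
    have hι : ∀ z, ‖ι z‖ = ‖z‖ := fun z => by
      simp [ι, Pi.norm_def, ContinuousLinearMap.coe_pi']
    have hιM : ∀ z, ι (L z) = M.mulVec (ι z) := fun z => by
      ext i
      simp [ι, L, M, Matrix.mulVec, dotProduct]
    obtain ⟨c, hc⟩ := hasGrowth_of_aeval_mulVec_eq_zero M (γ := γ) M.charpoly.roots
      (fun μ hμ => hF μ (Polynomial.isRoot_of_mem_roots hμ)) (fun t => ι (exp (t • L) x))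
      (fun t => by
        have h := (hasDerivAt_exp_smul_const' L t).clm_apply (hasDerivAt_const t x)
        refine (ι.hasFDerivAt.comp_hasDerivAt t h).congr_deriv ?_
        rw [← hιM]
        simp)
      (fun t => by
        rw [← (IsAlgClosed.splits M.charpoly).eq_prod_roots_of_monic M.charpoly_monic,
          Matrix.aeval_self_charpoly, Matrix.zero_mulVec])
    exact ⟨c, fun t ht => by simpa only [hι] using hc t ht⟩
  obtain ⟨C, hC⟩ := banach_steinhaus
    (g := fun t : Ici (0 : ℝ) => Real.exp (-(γ * t)) • exp ((t : ℝ) • L)) (fun x => by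
      obtain ⟨c, hc⟩ := hpt x
      refine ⟨c, fun t => ?_⟩
      rw [smul_apply, norm_smul, Real.norm_eq_abs, Real.abs_exp]
      calc _ ≤ Real.exp (-(γ * t)) * (c * Real.exp (γ * t)) := by gcongr; exact hc t t.2
        _ = c := by rw [mul_left_comm, ← Real.exp_add]; simp)
  refine ⟨C, fun t ht => ?_⟩
  have h := hC ⟨t, ht⟩
  rw [norm_smul, Real.norm_eq_abs, Real.abs_exp] at h
  calc ‖exp (t • L)‖ = Real.exp (-(γ * t)) * ‖exp (t • L)‖ * Real.exp (γ * t) := by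
        rw [mul_right_comm, ← Real.exp_add]; simp
    _ ≤ _ := by gcongr

end SpectralBounds

section Cutoff

variable {E F : Type*} [NormedAddCommGroup E] [NormedSpace ℝ E] [FiniteDimensional ℝ E]
  [NormedAddCommGroup F] [NormedSpace ℝ F]

/-- A bounded smooth Lipschitz map that is the identity near the origin. -/
theorem exists_smooth_retraction : ∃ (r : E → E) (M : NNReal), ContDiff ℝ 2 r ∧
    LipschitzWith M r ∧ (∀ p, ‖r p‖ ≤ 2) ∧ (∀ p, 2 ≤ ‖p‖ → r p = 0) ∧
    ∀ p, ‖p‖ ≤ 1 → r p = p := by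
  let χ : ContDiffBump (0 : E) := ⟨1, 2, one_pos, one_lt_two⟩
  have hχ0 : ∀ p, 2 ≤ ‖p‖ → χ p • p = 0 := fun p hp => by
    rw [χ.zero_of_le_dist (by simpa using hp), zero_smul]
  have hsm : ContDiff ℝ 2 fun p => χ p • p := χ.contDiff.smul contDiff_id
  obtain ⟨M, hM⟩ := ContDiff.lipschitzWith_of_hasCompactSupport
    (HasCompactSupport.intro (isCompact_closedBall (0 : E) 2) fun p hp => hχ0 p (by
      have : 2 < ‖p‖ := by simpa using hp
      exact this.le)) hsm two_ne_zero
  refine ⟨fun p => χ p • p, M, hsm, hM, fun p => ?_, hχ0, fun p hp => ?_⟩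
  · rcases le_total 2 ‖p‖ with hp | hp
    · simp [hχ0 p hp]
    · rw [norm_smul, Real.norm_of_nonneg χ.nonneg]
      exact (mul_le_of_le_one_left (norm_nonneg p) χ.le_one).trans hp
  · beta_reduce
    rw [χ.one_of_mem_closedBall (by simpa using hp), one_smul]

/-- A `C^2` map vanishing to first order at the origin agrees near the origin with a map whose
derivative is globally small and Lipschitz. -/
theorem exists_cutoff {f : E → F} (hf : ContDiff ℝ 2 f) (hf0 : f 0 = 0)
    (hDf0 : fderiv ℝ f 0 = 0) {ε : ℝ} (hε : 0 < ε) :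
    ∃ g : E → F, Differentiable ℝ g ∧ (∀ p, ‖fderiv ℝ g p‖ ≤ ε) ∧
      (∃ K, 0 ≤ K ∧ ∀ p q, ‖fderiv ℝ g p - fderiv ℝ g q‖ ≤ K * ‖p - q‖) ∧ g =ᶠ[𝓝 0] f := by
  obtain ⟨r, M, hr, hrM, hr2, hr0, hr1⟩ := exists_smooth_retraction (E := E)
  have hDfc : Continuous (fderiv ℝ f) := hf.continuous_fderiv two_ne_zero
  obtain ⟨ρ, hρ, hDf⟩ : ∃ ρ : ℝ, 0 < ρ ∧ ∀ q, ‖q‖ ≤ 2 * ρ → ‖fderiv ℝ f q‖ ≤ ε / (M + 1) := by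
    have h := hDfc.continuousAt (x := 0)
    rw [ContinuousAt, hDf0] at h
    have h' := h.norm.eventually_le_const (u := ε / (M + 1)) (by rw [norm_zero]; positivity)
    obtain ⟨R, hR, hball⟩ := Metric.eventually_nhds_iff.1 h'
    exact ⟨R / 4, by positivity, fun q hq => hball (by rw [dist_zero_right]; linarith)⟩
  have hs : ContDiff ℝ 2 fun p => ρ • r (ρ⁻¹ • p) :=
    contDiff_const.smul (hr.comp (contDiff_const.smul contDiff_id))
  have hsM : LipschitzWith M fun p => ρ • r (ρ⁻¹ • p) :=
    LipschitzWith.of_dist_le_mul fun p q => by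
      have h := hrM.dist_le_mul (ρ⁻¹ • p) (ρ⁻¹ • q)
      rw [dist_smul₀, Real.norm_of_nonneg (by positivity)] at h ⊢
      calc ρ * dist (r (ρ⁻¹ • p)) (r (ρ⁻¹ • q)) ≤ ρ * (M * (ρ⁻¹ * dist p q)) := by gcongr
        _ = M * dist p q := by field_simp
  have hg : ContDiff ℝ 2 fun p => f (ρ • r (ρ⁻¹ • p)) := hf.comp hs
  have hsupp : HasCompactSupport fun p => f (ρ • r (ρ⁻¹ • p)) :=
    HasCompactSupport.intro (isCompact_closedBall (0 : E) (2 * ρ)) fun p hp => by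
      have hp' : 2 * ρ < ‖p‖ := by simpa using hp
      rw [hr0, smul_zero, hf0]
      rw [norm_smul, norm_inv, Real.norm_of_nonneg hρ.le, ← div_eq_inv_mul, le_div_iff₀ hρ]
      exact hp'.le
  obtain ⟨K, hK⟩ := ContDiff.lipschitzWith_of_hasCompactSupport (hsupp.fderiv ℝ)
    (hg.fderiv_right (m := 1) (by norm_num)) one_ne_zero
  refine ⟨_, hg.differentiable two_ne_zero, fun p => ?_, ⟨K, K.2, fun p q => ?_⟩, ?_⟩
  · have hcomp := fderiv_comp p (hf.differentiable two_ne_zero (ρ • r (ρ⁻¹ • p)))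
      (hs.differentiable two_ne_zero p)
    change ‖fderiv ℝ (f ∘ fun p => ρ • r (ρ⁻¹ • p)) p‖ ≤ ε
    rw [hcomp]
    calc _ ≤ ‖fderiv ℝ f (ρ • r (ρ⁻¹ • p))‖ * ‖fderiv ℝ (fun p => ρ • r (ρ⁻¹ • p)) p‖ :=
          ContinuousLinearMap.opNorm_comp_le _ _
      _ ≤ ε / (M + 1) * M := by
          gcongr
          · refine hDf _ ?_
            rw [norm_smul, Real.norm_of_nonneg hρ.le, mul_comm]
            gcongr
            exact hr2 _
          · exact norm_fderiv_le_of_lipschitz ℝ hsM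
      _ ≤ ε := by
          rw [div_mul_eq_mul_div, div_le_iff₀ (by positivity)]
          gcongr
          linarith
  · simpa only [dist_eq_norm] using hK.dist_le_mul p q
  · filter_upwards [Metric.closedBall_mem_nhds (0 : E) hρ] with p hp
    rw [hr1, smul_inv_smul₀ hρ.ne']
    rw [norm_smul, norm_inv, Real.norm_of_nonneg hρ.le, ← div_eq_inv_mul, div_le_one hρ]
    simpa using hp

end Cutoff

/-- Exponential bounds for the reversed center flow and the stable flow. -/
theorem exists_hasSplitBounds {d m : ℕ}
    (F₁ : Matrix (Fin d) (Fin d) ℝ) (F₂ : Matrix (Fin m) (Fin m) ℝ)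
    (hF₁ : ∀ μ : ℂ, ((F₁.map (algebraMap ℝ ℂ)).charpoly.IsRoot μ) → μ.re = 0)
    (hF₂ : ∀ μ : ℂ, ((F₂.map (algebraMap ℝ ℂ)).charpoly.IsRoot μ) → μ.re < 0) :
    ∃ C δ, HasSplitBounds (-F₁).mulVecLin.toContinuousLinearMap
      F₂.mulVecLin.toContinuousLinearMap C δ := by
  obtain ⟨δ, hδ, hgap⟩ : ∃ δ : ℝ, 0 < δ ∧
      ∀ μ ∈ (F₂.map (algebraMap ℝ ℂ)).charpoly.roots.toFinset, μ.re < -(5 * δ) := by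
    have h : ∀ᶠ δ : ℝ in 𝓝[>] 0,
        ∀ μ ∈ (F₂.map (algebraMap ℝ ℂ)).charpoly.roots.toFinset, μ.re < -(5 * δ) := by
      refine (Finset.eventually_all _).2 fun μ hμ => ?_
      have hlim : Tendsto (fun δ : ℝ => -(5 * δ)) (𝓝[>] 0) (𝓝 0) := by
        refine Tendsto.mono_left ?_ nhdsWithin_le_nhds
        simpa using (by fun_prop : Continuous fun δ : ℝ => -(5 * δ)).tendsto 0
      exact hlim.eventually_const_lt
        (hF₂ μ (Polynomial.isRoot_of_mem_roots (Multiset.mem_toFinset.1 hμ)))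
    obtain ⟨δ, hδ, hpos⟩ := (h.and self_mem_nhdsWithin).exists
    exact ⟨δ, hpos, hδ⟩
  obtain ⟨C₁, hC₁⟩ := exists_norm_exp_smul_le (-F₁) (γ := δ) fun μ hμ => by
    have hneg : (-F₁).map (algebraMap ℝ ℂ) = -F₁.map (algebraMap ℝ ℂ) := by
      ext; simp
    rw [hneg, ← Matrix.mem_spectrum_iff_isRoot_charpoly, ← spectrum.neg_eq, Set.mem_neg,
      Matrix.mem_spectrum_iff_isRoot_charpoly] at hμ
    have h := hF₁ _ hμ
    rw [Complex.neg_re, neg_eq_zero] at h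
    rwa [h]
  obtain ⟨C₂, hC₂⟩ := exists_norm_exp_smul_le F₂ (γ := -(5 * δ)) fun μ hμ => hgap μ
    (Multiset.mem_toFinset.2 ((Polynomial.mem_roots (Matrix.charpoly_monic _).ne_zero).2 hμ))
  refine ⟨max 0 (max C₁ C₂), δ, le_max_left _ _, hδ, fun t ht => (hC₁ t ht).trans ?_,
    fun t ht => (hC₂ t ht).trans ?_⟩
  · gcongr
    exact (le_max_left _ _).trans (le_max_right _ _)
  · gcongr
    exact (le_max_right _ _).trans (le_max_right _ _)

end CenterManifold

/-- Existence of a center manifold.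
Under the hypotheses that all complex eigenvalues of `F₁` have zero real part, all
complex eigenvalues of `F₂` have negative real part, and `f̄₁, f̄₂` are twice
continuously differentiable vanishing to first order at the origin, there exist a
neighborhood `Ω` of `0 ∈ ℝ^d` and a continuously differentiable `h` with `h 0 = 0`,
`Dh 0 = 0`, satisfying the invariance PDE on `Ω`. -/
theorem center_manifold_existence {d m : ℕ}
    (F₁ : Matrix (Fin d) (Fin d) ℝ) (F₂ : Matrix (Fin m) (Fin m) ℝ)
    (hF₁ : ∀ μ : ℂ, ((F₁.map (algebraMap ℝ ℂ)).charpoly.IsRoot μ) → μ.re = 0)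
    (hF₂ : ∀ μ : ℂ, ((F₂.map (algebraMap ℝ ℂ)).charpoly.IsRoot μ) → μ.re < 0)
    (f₁ : (Fin d → ℝ) → (Fin m → ℝ) → (Fin d → ℝ))
    (f₂ : (Fin d → ℝ) → (Fin m → ℝ) → (Fin m → ℝ))
    (hf₁ : ContDiff ℝ 2 (fun p : (Fin d → ℝ) × (Fin m → ℝ) => f₁ p.1 p.2))
    (hf₂ : ContDiff ℝ 2 (fun p : (Fin d → ℝ) × (Fin m → ℝ) => f₂ p.1 p.2))
    (hf₁0 : f₁ 0 0 = 0) (hf₂0 : f₂ 0 0 = 0)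
    (hDf₁0 : fderiv ℝ (fun p : (Fin d → ℝ) × (Fin m → ℝ) => f₁ p.1 p.2) (0, 0) = 0)
    (hDf₂0 : fderiv ℝ (fun p : (Fin d → ℝ) × (Fin m → ℝ) => f₂ p.1 p.2) (0, 0) = 0) :
    ∃ (Ω : Set (Fin d → ℝ)) (h : (Fin d → ℝ) → (Fin m → ℝ)),
      IsOpen Ω ∧ 0 ∈ Ω ∧ ContDiffOn ℝ 1 h Ω ∧ h 0 = 0 ∧ fderiv ℝ h 0 = 0 ∧
      ∀ x ∈ Ω, fderiv ℝ h x (F₁.mulVec x + f₁ x (h x)) =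
        F₂.mulVec (h x) + f₂ x (h x) := by
  obtain ⟨C, δ, hAB⟩ := CenterManifold.exists_hasSplitBounds F₁ F₂ hF₁ hF₂
  have hδ := hAB.pos
  have hC := hAB.nonneg
  have hfd : fderiv ℝ (fun p : (Fin d → ℝ) × (Fin m → ℝ) => -(f₁ p.1 p.2, f₂ p.1 p.2)) 0 = 0 := by
    rw [fderiv_fun_neg, DifferentiableAt.fderiv_prodMk (hf₁.differentiable two_ne_zero 0)
      (hf₂.differentiable two_ne_zero 0), ← Prod.mk_zero_zero, hDf₁0, hDf₂0]
    ext <;> simp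
  obtain ⟨g, hg, hgε, ⟨K, hK, hgK⟩, hgf⟩ := CenterManifold.exists_cutoff
    (hf₁.prodMk hf₂).neg (by simp [hf₁0, hf₂0]) hfd (ε := δ / (2 * (C + 1))) (by positivity)
  obtain ⟨h, hh, hh0, hDh0, hinv⟩ := CenterManifold.exists_global_invariant_graph hAB
    (by positivity) (by
      rw [div_mul_div_comm, div_le_div_iff₀ (by positivity) two_pos]
      nlinarith) hg hgε hK hgK (by simp [hgf.eq_of_nhds, hf₁0, hf₂0])
    (by rw [hgf.fderiv_eq, hfd])
  have hcont : Tendsto (fun x => (x, h x)) (𝓝 0) (𝓝 0) := by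
    have := (continuous_id.prodMk hh.continuous).tendsto 0
    simpa [hh0, ← Prod.mk_zero_zero] using this
  obtain ⟨Ω, hΩ, hΩo, h0Ω⟩ := eventually_nhds_iff.1 (hcont.eventually hgf)
  refine ⟨Ω, h, hΩo, h0Ω, hh.contDiffOn, hh0, hDh0, fun x hx => ?_⟩
  have hx' := hinv x
  rw [hΩ x hx] at hx'
  have hl : (-F₁).mulVecLin.toContinuousLinearMap x + (-(f₁ x (h x), f₂ x (h x))).1 =
      -(F₁.mulVec x + f₁ x (h x)) := by
    simp [add_comm]
  have hr : -F₂.mulVecLin.toContinuousLinearMap (h x) + (-(f₁ x (h x), f₂ x (h x))).2 =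
      -(F₂.mulVec (h x) + f₂ x (h x)) := by
    simp [add_comm]
  rw [hl, hr, map_neg] at hx'
  exact neg_injective hx'
end

section
/- Let h : Ω → ℝ^m be a center manifold for the system. Then solutions near the origin converge exponentially to the center manifold: there exist a neighborhood U of (0,0) in ℝ^d × ℝ^m and constants C > 0, γ > 0 such that every solution (x(t), y(t)) of the full system on [0,∞) with (x(0), y(0)) ∈ U and (x(t), y(t)) remaining in U with x(t) ∈ Ω for all t ≥ 0 satisfies ‖y(t) − h(x(t))‖ ≤ C e^{−γt} ‖y(0) − h(x(0))‖ for all t ≥ 0. -/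
open Set Topology

/-- If `‖A ^ N v‖ ≤ q ^ N ‖v‖`, then some injective linear map `T` into `E ^ N` pulls the sup norm
back to a norm on `E` for which `A` is `q`-Lipschitz. -/
lemma ContinuousLinearMap.exists_norm_map_le_of_norm_pow_le {E : Type*} [NormedAddCommGroup E] [NormedSpace ℝ E]
    (A : E →L[ℝ] E) {N : ℕ} (hN : 0 < N) {q : ℝ} (hq : 0 < q)
    (h : ∀ v, ‖(A ^ N) v‖ ≤ q ^ N * ‖v‖) :
    ∃ T : E →L[ℝ] (Fin N → E), (∀ v, ‖v‖ ≤ ‖T v‖) ∧ ∀ v, ‖T (A v)‖ ≤ q * ‖T v‖ := by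
  let T : E →L[ℝ] (Fin N → E) :=
    ContinuousLinearMap.pi fun n : Fin N => (q ^ (n : ℕ))⁻¹ • A ^ (n : ℕ)
  have hT (v : E) (n : ℕ) (hn : n < N) : ‖(A ^ n) v‖ ≤ q ^ n * ‖T v‖ := by
    have := norm_le_pi_norm (T v) ⟨n, hn⟩
    simp only [T, ContinuousLinearMap.coe_pi', smul_apply, norm_smul,
      norm_inv, norm_pow, Real.norm_of_nonneg hq.le] at this
    rwa [inv_mul_le_iff₀ (by positivity)] at this
  have h0 (v : E) : ‖v‖ ≤ ‖T v‖ := by simpa using hT v 0 hN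
  refine ⟨T, h0, fun v => (pi_norm_le_iff_of_nonneg (by positivity)).2 fun n => ?_⟩
  have hstep : ‖(A ^ ((n : ℕ) + 1)) v‖ ≤ q ^ ((n : ℕ) + 1) * ‖T v‖ := by
    rcases (Nat.succ_le_of_lt n.2).lt_or_eq with hn | hn
    · exact hT v _ hn
    · rw [Nat.succ_eq_add_one] at hn
      rw [hn]
      exact (h v).trans (by gcongr; exact h0 v)
  have e : T (A v) n = (q ^ (n : ℕ))⁻¹ • (A ^ ((n : ℕ) + 1)) v := by
    simp [T, pow_succ]
  rw [e, norm_smul, norm_inv, norm_pow, Real.norm_of_nonneg hq.le,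
    inv_mul_le_iff₀ (by positivity), ← mul_assoc, ← pow_succ]
  exact hstep

/-- Exponential decay for `z' = F z + R` with `‖R‖ ≤ ε ‖z‖`, when `F + s` has norm at most `q` in
the norm pulled back along `T`. -/
lemma norm_le_exp_mul_of_hasDerivWithinAt_perturbation {E G : Type*} [NormedAddCommGroup E] [NormedSpace ℝ E]
    [NormedAddCommGroup G] [NormedSpace ℝ G] (F : E →L[ℝ] E) (T : E →L[ℝ] G) {s q ε : ℝ}
    (hT : ∀ v, ‖v‖ ≤ ‖T v‖) (hTF : ∀ v, ‖T (F v + s • v)‖ ≤ q * ‖T v‖) {z R : ℝ → E} (hε : 0 ≤ ε)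
    (hz : ∀ t ∈ Ici (0 : ℝ), HasDerivWithinAt z (F (z t) + R t) (Ici 0) t)
    (hR : ∀ t ∈ Ici (0 : ℝ), ‖R t‖ ≤ ε * ‖z t‖) {t : ℝ} (ht : 0 ≤ t) :
    ‖z t‖ ≤ ‖T‖ * Real.exp (-(s - q - ‖T‖ * ε) * t) * ‖z 0‖ := by
  have hu (r : ℝ) (hr : r ∈ Ici (0 : ℝ)) :
      HasDerivWithinAt (fun r => Real.exp (s * r) • T (z r))
        (Real.exp (s * r) • (T (F (z r) + s • z r) + T (R r))) (Ici 0) r := by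
    have h1 : HasDerivWithinAt (fun r : ℝ => Real.exp (s * r)) (Real.exp (s * r) * s) (Ici 0) r := by
      simpa using (((hasDerivAt_id r).const_mul s).exp).hasDerivWithinAt
    have h2 := T.hasFDerivAt.comp_hasDerivWithinAt r (hz r hr)
    refine (h1.smul h2).congr_deriv ?_
    simp only [map_add, map_smul, Function.comp]
    module
  have key := norm_le_gronwallBound_of_norm_deriv_right_le (a := 0) (b := t)
    (f := fun r => Real.exp (s * r) • T (z r)) (δ := ‖T (z 0)‖) (K := q + ‖T‖ * ε) (ε := 0)
    (fun r hr => ((hu r hr.1).continuousWithinAt).mono Icc_subset_Ici_self)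
    (fun r hr => (hu r hr.1).mono (Ici_subset_Ici.2 hr.1)) (by simp)
    (fun r hr => by
      simp only [norm_smul, Real.norm_of_nonneg (Real.exp_pos _).le, add_zero]
      rw [mul_left_comm]
      gcongr
      refine (norm_add_le _ _).trans ?_
      rw [add_mul]
      refine add_le_add (hTF _) ((T.le_opNorm _).trans ?_)
      rw [mul_assoc]
      gcongr
      exact (hR r hr.1).trans (by gcongr; exact hT _)) t ⟨ht, le_rfl⟩
  rw [gronwallBound_ε0, sub_zero, norm_smul, Real.norm_of_nonneg (Real.exp_pos _).le] at key
  have h3 : Real.exp (-(s - q - ‖T‖ * ε) * t)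
      = Real.exp ((q + ‖T‖ * ε) * t) * (Real.exp (s * t))⁻¹ := by
    rw [← Real.exp_neg, ← Real.exp_add]; ring_nf
  calc ‖z t‖ ≤ ‖T (z t)‖ := hT _
    _ ≤ (Real.exp (s * t))⁻¹ * (‖T (z 0)‖ * Real.exp ((q + ‖T‖ * ε) * t)) := by
      rwa [le_inv_mul_iff₀ (Real.exp_pos _)]
    _ ≤ (Real.exp (s * t))⁻¹ * ((‖T‖ * ‖z 0‖) * Real.exp ((q + ‖T‖ * ε) * t)) := by
      gcongr; exact T.le_opNorm _
    _ = _ := by rw [h3]; ring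

section LinftyOpNorm

attribute [local instance] Matrix.linftyOpNormedAddCommGroup Matrix.linftyOpNormedRing
  Matrix.linftyOpNormedAlgebra

/-- If all complex eigenvalues of `A` have modulus less than `s`, some power satisfies
`‖A ^ N v‖ ≤ q ^ N ‖v‖` with `q < s`. -/
lemma Matrix.exists_norm_pow_mulVec_le {m : ℕ} (A : Matrix (Fin m) (Fin m) ℝ) {s : ℝ} (hs : 0 < s)
    (hA : ∀ μ ∈ spectrum ℂ (A.map (algebraMap ℝ ℂ)), ‖μ‖ < s) :
    ∃ q, 0 < q ∧ q < s ∧ ∃ N : ℕ, 0 < N ∧ ∀ v, ‖(A ^ N).mulVec v‖ ≤ q ^ N * ‖v‖ := by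
  set a := A.map (algebraMap ℝ ℂ) with ha
  lift s to NNReal using hs.le
  have hr : spectralRadius ℂ a < s := by
    rcases (spectrum ℂ a).eq_empty_or_nonempty with he | hne
    · rw [spectralRadius, he]
      simpa using hs
    · exact spectrum.spectralRadius_lt_of_forall_lt_of_nonempty hne fun k hk => hA k hk
  obtain ⟨q, hrq, hqs⟩ := ENNReal.lt_iff_exists_nnreal_btwn.1 hr
  have hq : 0 < q := by exact_mod_cast zero_le.trans_lt hrq
  obtain ⟨N, hNq, hN⟩ := (((spectrum.pow_nnnorm_pow_one_div_tendsto_nhds_spectralRadius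
    a).eventually_lt_const hrq).and (Filter.eventually_gt_atTop 0)).exists
  have hpow : ‖a ^ N‖ ≤ (q : ℝ) ^ N := by
    rw [one_div, ENNReal.rpow_inv_lt_iff (by exact_mod_cast hN), ENNReal.rpow_natCast] at hNq
    exact_mod_cast hNq.le
  refine ⟨q, hq, by exact_mod_cast hqs, N, hN, fun v => ?_⟩
  have hnorm (w : Fin m → ℝ) : ‖(algebraMap ℝ ℂ) ∘ w‖ = ‖w‖ := by
    simp [Pi.norm_def, Function.comp_def]
  have hmap : (algebraMap ℝ ℂ) ∘ ((A ^ N).mulVec v) = (a ^ N).mulVec ((algebraMap ℝ ℂ) ∘ v) := by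
    ext i
    rw [ha, ← Matrix.map_pow]
    exact RingHom.map_mulVec _ _ _ i
  rw [← hnorm, hmap, ← hnorm v]
  exact (Matrix.linfty_opNorm_mulVec _ _).trans (by gcongr)

end LinftyOpNorm

/-- A shift by a large real number puts a finite subset of the open left half plane inside a
disc centred at the origin. -/
lemma Complex.exists_forall_norm_add_lt {S : Set ℂ} (hS : S.Finite) (hre : ∀ μ ∈ S, μ.re < 0) :
    ∃ s : ℝ, 0 < s ∧ ∀ μ ∈ S, ‖(s : ℂ) + μ‖ < s := by
  have h1 : ∀ᶠ s : ℝ in Filter.atTop, ∀ μ ∈ S, ‖(s : ℂ) + μ‖ < s := by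
    refine (Filter.eventually_all_finite hS).2 fun μ hμ => ?_
    have hneg := hre μ hμ
    filter_upwards [Filter.eventually_gt_atTop 0,
      Filter.eventually_gt_atTop ((μ.re ^ 2 + μ.im ^ 2) / (-2 * μ.re))] with s hs hsμ
    rw [div_lt_iff₀ (by linarith)] at hsμ
    refine lt_of_pow_lt_pow_left₀ 2 hs.le ?_
    rw [Complex.sq_norm, Complex.normSq_apply]
    simp
    nlinarith
  exact ((Filter.eventually_gt_atTop 0).and h1).exists

/-- A Hurwitz matrix, after a shift by `s > 0`, becomes a contraction with constant `q < s` in a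
suitable norm. -/
lemma Matrix.exists_adapted_norm_of_charpoly_re_neg {m : ℕ} (F : Matrix (Fin m) (Fin m) ℝ)
    (hF : ∀ μ : ℂ, (F.map (algebraMap ℝ ℂ)).charpoly.IsRoot μ → μ.re < 0) :
    ∃ (s q : ℝ) (N : ℕ) (T : (Fin m → ℝ) →L[ℝ] (Fin N → Fin m → ℝ)), q < s ∧
      (∀ v, ‖v‖ ≤ ‖T v‖) ∧ ∀ v, ‖T (F.mulVec v + s • v)‖ ≤ q * ‖T v‖ := by
  obtain ⟨s, hs, hsF⟩ := Complex.exists_forall_norm_add_lt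
    (S := spectrum ℂ (F.map (algebraMap ℝ ℂ))) (Matrix.finite_spectrum _)
    fun μ hμ => hF μ (Matrix.mem_spectrum_iff_isRoot_charpoly.1 hμ)
  obtain ⟨q, hq, hqs, N, hN, hpow⟩ :=
    Matrix.exists_norm_pow_mulVec_le (algebraMap ℝ _ s + F) hs fun μ hμ => by
      have e : (algebraMap ℝ (Matrix (Fin m) (Fin m) ℝ) s + F).map (algebraMap ℝ ℂ)
          = algebraMap ℂ _ (s : ℂ) + F.map (algebraMap ℝ ℂ) := by
        ext i j
        simp [Matrix.algebraMap_matrix_apply, apply_ite]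
      rw [e, ← sub_add_cancel μ (s : ℂ), spectrum.add_mem_add_iff] at hμ
      simpa using hsF _ hμ
  let A : (Fin m → ℝ) →L[ℝ] (Fin m → ℝ) :=
    (Matrix.toLin' (algebraMap ℝ _ s + F)).toContinuousLinearMap
  have hA (n : ℕ) (v : Fin m → ℝ) : (A ^ n) v = ((algebraMap ℝ _ s + F) ^ n).mulVec v := by
    induction n generalizing v with
    | zero => simp
    | succ n ih =>
      rw [pow_succ, pow_succ, ← Matrix.mulVec_mulVec, ← ih]
      rfl
  obtain ⟨T, hT, hTA⟩ := A.exists_norm_map_le_of_norm_pow_le hN hq fun v => hA N v ▸ hpow v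
  refine ⟨s, q, N, T, hqs, hT, fun v => ?_⟩
  have hAv : A v = F.mulVec v + s • v := by
    simp [A, Algebra.algebraMap_eq_smul_one, add_comm]
  exact hAv ▸ hTA v

/-- Solutions of the full system that start near the origin and remain
near it converge exponentially fast to the center manifold `h`. -/
theorem exponential_attraction_to_center_manifold {d m : ℕ}
    (F₁ : Matrix (Fin d) (Fin d) ℝ) (F₂ : Matrix (Fin m) (Fin m) ℝ)
    (hF₁ : ∀ μ : ℂ, ((F₁.map (algebraMap ℝ ℂ)).charpoly.IsRoot μ) → μ.re = 0)
    (hF₂ : ∀ μ : ℂ, ((F₂.map (algebraMap ℝ ℂ)).charpoly.IsRoot μ) → μ.re < 0)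
    (f₁ : (Fin d → ℝ) → (Fin m → ℝ) → (Fin d → ℝ))
    (f₂ : (Fin d → ℝ) → (Fin m → ℝ) → (Fin m → ℝ))
    (hf₁ : ContDiff ℝ 2 (fun p : (Fin d → ℝ) × (Fin m → ℝ) => f₁ p.1 p.2))
    (hf₂ : ContDiff ℝ 2 (fun p : (Fin d → ℝ) × (Fin m → ℝ) => f₂ p.1 p.2))
    (hf₁0 : f₁ 0 0 = 0) (hf₂0 : f₂ 0 0 = 0)
    (hDf₁0 : fderiv ℝ (fun p : (Fin d → ℝ) × (Fin m → ℝ) => f₁ p.1 p.2) (0, 0) = 0)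
    (hDf₂0 : fderiv ℝ (fun p : (Fin d → ℝ) × (Fin m → ℝ) => f₂ p.1 p.2) (0, 0) = 0)
    (Ω : Set (Fin d → ℝ)) (hΩopen : IsOpen Ω) (hΩ0 : 0 ∈ Ω)
    (h : (Fin d → ℝ) → (Fin m → ℝ)) (hh : ContDiffOn ℝ 1 h Ω)
    (hh0 : h 0 = 0) (hDh0 : fderiv ℝ h 0 = 0)
    (hpde : ∀ x ∈ Ω, fderiv ℝ h x (F₁.mulVec x + f₁ x (h x)) =
      F₂.mulVec (h x) + f₂ x (h x)) :
    ∃ (U : Set ((Fin d → ℝ) × (Fin m → ℝ))), U ∈ 𝓝 ((0, 0) : (Fin d → ℝ) × (Fin m → ℝ)) ∧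
      ∃ C > (0 : ℝ), ∃ γ > (0 : ℝ),
        ∀ (x : ℝ → (Fin d → ℝ)) (y : ℝ → (Fin m → ℝ)),
          (∀ t ∈ Ici (0 : ℝ),
            HasDerivWithinAt x (F₁.mulVec (x t) + f₁ (x t) (y t)) (Ici 0) t ∧
            HasDerivWithinAt y (F₂.mulVec (y t) + f₂ (x t) (y t)) (Ici 0) t) →
          (x 0, y 0) ∈ U →
          (∀ t ∈ Ici (0 : ℝ), (x t, y t) ∈ U ∧ x t ∈ Ω) →
          ∀ t ∈ Ici (0 : ℝ),
            ‖y t - h (x t)‖ ≤ C * Real.exp (-γ * t) * ‖y 0 - h (x 0)‖ := by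
  obtain ⟨s, q, N, T, hqs, hT, hTF⟩ := F₂.exists_adapted_norm_of_charpoly_re_neg hF₂
  obtain ⟨ε, hε, hεT⟩ : ∃ ε : NNReal, 0 < ε ∧ ‖T‖ * (2 * ε) < s - q := by
    have hc : Filter.Tendsto (fun ε : ℝ => ‖T‖ * (2 * ε)) (𝓝[>] 0) (𝓝 0) :=
      tendsto_nhdsWithin_of_tendsto_nhds ((by fun_prop : Continuous _).tendsto' _ _ (by simp))
    obtain ⟨ε, h1, h2⟩ :=
      ((hc.eventually_lt_const (sub_pos.2 hqs)).and self_mem_nhdsWithin).exists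
    exact ⟨⟨ε, le_of_lt h2⟩, h2, h1⟩
  have hlip {k : ℕ} (f : (Fin d → ℝ) × (Fin m → ℝ) → (Fin k → ℝ)) (hf : ContDiff ℝ 2 f)
      (hf0 : fderiv ℝ f (0, 0) = 0) : ∃ V ∈ 𝓝 (0, 0), LipschitzOnWith ε f V :=
    (hf.contDiffAt.hasStrictFDerivAt (by norm_num)).exists_lipschitzOnWith_of_nnnorm_lt ε
      (by simpa [hf0] using hε)
  obtain ⟨V₁, hV₁, hL₁⟩ := hlip _ hf₁ hDf₁0
  obtain ⟨V₂, hV₂, hL₂⟩ := hlip _ hf₂ hDf₂0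
  have hh0' : ContDiffAt ℝ 1 h 0 := hh.contDiffAt (hΩopen.mem_nhds hΩ0)
  have hgraph : Filter.Tendsto (fun p : (Fin d → ℝ) × (Fin m → ℝ) => (p.1, h p.1))
      (𝓝 (0, 0)) (𝓝 (0, 0)) := by
    have h1 : ContinuousAt (fun x => (x, h x)) 0 := continuousAt_id.prodMk hh0'.continuousAt
    have h2 : Filter.Tendsto (fun x => (x, h x)) (𝓝 0) (𝓝 (0, 0)) := by
      simpa [ContinuousAt, hh0] using h1
    exact h2.comp (continuous_fst.tendsto (0, 0))
  have hDh : ∀ᶠ p : (Fin d → ℝ) × (Fin m → ℝ) in 𝓝 (0, 0), ‖fderiv ℝ h p.1‖ < 1 := by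
    have h1 : Filter.Tendsto (fun x => ‖fderiv ℝ h x‖) (𝓝 0) (𝓝 0) := by
      have := (hh0'.continuousAt_fderiv one_ne_zero).norm
      simpa [ContinuousAt, hDh0] using this
    exact (h1.comp (continuous_fst.tendsto (0, 0))).eventually_lt_const one_pos
  have hV := Filter.inter_mem hV₁ hV₂
  refine ⟨{p | (p ∈ V₁ ∩ V₂ ∧ (p.1, h p.1) ∈ V₁ ∩ V₂) ∧ ‖fderiv ℝ h p.1‖ < 1},
    Filter.inter_mem (Filter.inter_mem hV (hgraph hV)) hDh,
    ‖T‖ + 1, by positivity, s - q - ‖T‖ * (2 * ε), by linarith, ?_⟩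
  intro x y hsol _ hU t ht
  let R (t : ℝ) : Fin m → ℝ := (f₂ (x t) (y t) - f₂ (x t) (h (x t))) -
    fderiv ℝ h (x t) (f₁ (x t) (y t) - f₁ (x t) (h (x t)))
  have hz (r : ℝ) (hr : r ∈ Ici (0 : ℝ)) : HasDerivWithinAt (fun t => y t - h (x t))
      (F₂.mulVecLin.toContinuousLinearMap (y r - h (x r)) + R r) (Ici 0) r := by
    have hxΩ := (hU r hr).2
    have hd : HasFDerivAt h (fderiv ℝ h (x r)) (x r) :=
      ((hh.contDiffAt (hΩopen.mem_nhds hxΩ)).differentiableAt one_ne_zero).hasFDerivAt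
    refine ((hsol r hr).2.sub (hd.comp_hasDerivWithinAt r (hsol r hr).1)).congr_deriv ?_
    have hp := hpde _ hxΩ
    simp only [map_add] at hp
    simp only [R, LinearMap.coe_toContinuousLinearMap', Matrix.mulVecLin_apply,
      map_add, map_sub]
    linear_combination -hp
  have hR (r : ℝ) (hr : r ∈ Ici (0 : ℝ)) : ‖R r‖ ≤ (2 * ε) * ‖y r - h (x r)‖ := by
    obtain ⟨⟨hV, hVh⟩, hD⟩ := (hU r hr).1
    have e : ‖(x r, y r) - (x r, h (x r))‖ = ‖y r - h (x r)‖ := by simp [Prod.norm_def]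
    have b₁ := hL₁.norm_sub_le hV.1 hVh.1
    have b₂ := hL₂.norm_sub_le hV.2 hVh.2
    rw [e] at b₁ b₂
    have b₃ := (fderiv ℝ h (x r)).le_of_opNorm_le hD.le (f₁ (x r) (y r) - f₁ (x r) (h (x r)))
    have b₄ := norm_sub_le (f₂ (x r) (y r) - f₂ (x r) (h (x r)))
      (fderiv ℝ h (x r) (f₁ (x r) (y r) - f₁ (x r) (h (x r))))
    simp only [R]
    linarith
  have hdecay := norm_le_exp_mul_of_hasDerivWithinAt_perturbation
    F₂.mulVecLin.toContinuousLinearMap T hT hTF (mul_nonneg zero_le_two ε.2) hz hR ht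
  refine hdecay.trans (mul_le_mul_of_nonneg_right (mul_le_mul_of_nonneg_right ?_ ?_) ?_)
  · exact (lt_add_one _).le
  · exact (Real.exp_pos _).le
  · exact norm_nonneg _
end

section
/- Let f : D → ℝ^n be continuously differentiable on an open set D ⊆ ℝ^n containing 0, with f(0) = 0, and let F = Df(0) be the Jacobian of f at 0. If every complex eigenvalue of F has negative real part, then the equilibrium 0 of ẋ = f(x) is locally asymptotically stable. -/
open Set Topology Filter

/-- An endomorphism of a finite-dimensional complex space all of whose eigenvalues have negative
real part is strictly dissipative for the inner product pulled back along a suitable embedding. -/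
theorem Module.End.exists_injective_inner_le_neg {V : Type*} [AddCommGroup V] [Module ℂ V]
    [FiniteDimensional ℂ V] (T : Module.End ℂ V) (hT : ∀ μ, T.HasEigenvalue μ → μ.re < 0) :
    ∃ (H : Type) (_ : NormedAddCommGroup H) (_ : InnerProductSpace ℂ H) (L : V →ₗ[ℂ] H) (α : ℝ),
      Function.Injective L ∧ 0 < α ∧ ∀ x, (inner ℂ (L x) (L (T x))).re ≤ -α * ‖L x‖ ^ 2 := by
  induction hd : Module.finrank ℂ V generalizing V with
  | zero =>
    have : Subsingleton V := Module.finrank_zero_iff.mp hd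
    exact ⟨ℂ, inferInstance, inferInstance, 0, 1, Function.injective_of_subsingleton _,
      one_pos, by simp⟩
  | succ d ih =>
    have : Nontrivial V := Module.nontrivial_of_finrank_pos (R := ℂ) (by omega)
    obtain ⟨μ, hμ⟩ := T.exists_eigenvalue
    have hrange : LinearMap.range (T - algebraMap ℂ (Module.End ℂ V) μ) < ⊤ := by
      rw [lt_top_iff_ne_top, Ne, LinearMap.range_eq_top, ← LinearMap.injective_iff_surjective]
      intro hinj
      obtain ⟨v, hv⟩ := hμ.exists_hasEigenvector
      refine hv.2 (hinj ?_)
      simp [hv.apply_eq_smul]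
    obtain ⟨φ, hφ, hle⟩ := Submodule.exists_le_ker_of_lt_top _ hrange
    have hφT (x : V) : φ (T x) = μ * φ x := by
      have h : φ ((T - algebraMap ℂ (Module.End ℂ V) μ) x) = 0 := hle ⟨x, rfl⟩
      simpa [sub_eq_zero] using h
    obtain ⟨v, hv⟩ := LinearMap.surjective hφ 1
    have hmaps : ∀ x ∈ LinearMap.ker φ, T x ∈ LinearMap.ker φ := fun x hx ↦ by
      rw [LinearMap.mem_ker] at hx ⊢
      rw [hφT, hx, mul_zero]
    have hfin := Module.Dual.finrank_ker_add_one_of_ne_zero hφ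
    obtain ⟨H, _, _, L, α, hL, hα, hLα⟩ := ih (T.restrict hmaps) (fun ν hν ↦ by
      obtain ⟨w, hw⟩ := hν.exists_hasEigenvector
      refine hT ν (Module.End.hasEigenvalue_of_hasEigenvector (x := (w : V)) ⟨?_, ?_⟩)
      · rw [Module.End.mem_eigenspace_iff]
        exact congrArg Subtype.val hw.apply_eq_smul
      · simpa using hw.2) (by omega)
    let π : V →ₗ[ℂ] LinearMap.ker φ :=
      (LinearMap.id - φ.smulRight v).codRestrict _ (fun x ↦ by simp [hv])
    have hπ (x : V) : (π x : V) = x - φ x • v := rfl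
    have hπT (x : V) : π (T x) = T.restrict hmaps (π x) + φ x • π (T v) := by
      ext
      simp only [Submodule.coe_add, Submodule.coe_smul, LinearMap.coe_restrict_apply, hπ, hφT, hv,
        map_sub, map_smul]
      module
    set b := ‖L (π (T v))‖ with hb
    obtain ⟨γ, hγ, hγα, hγμ⟩ : ∃ γ > 0, γ ≤ α ∧ γ ≤ -μ.re :=
      ⟨min α (-μ.re), lt_min hα (neg_pos.mpr (hT μ hμ)), min_le_left _ _, min_le_right _ _⟩
    obtain ⟨M, hM, hMb⟩ : ∃ M > 0, b ≤ γ * M :=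
      ⟨(b + 1) / γ, by positivity, by field_simp; linarith⟩
    let L' : V →ₗ[ℂ] WithLp 2 (H × ℂ) :=
      (WithLp.linearEquiv 2 ℂ (H × ℂ)).symm.toLinearMap ∘ₗ (L ∘ₗ π).prod ((M : ℂ) • φ)
    have hL'1 (x : V) : (L' x).fst = L (π x) := rfl
    have hL'2 (x : V) : (L' x).snd = (M : ℂ) * φ x := rfl
    refine ⟨WithLp 2 (H × ℂ), inferInstance, inferInstance, L', γ / 2, ?_, by positivity,
      fun x ↦ ?_⟩
    · rw [injective_iff_map_eq_zero]
      intro x hx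
      have h2 : φ x = 0 := by
        have := hL'2 x
        simpa [hx, hM.ne'] using this.symm
      have h1 : π x = 0 := hL (by rw [← hL'1 x, hx]; simp)
      have h3 := hπ x
      rw [h1, h2] at h3
      simpa using h3.symm
    · have hsnd : (inner ℂ ((M : ℂ) * φ x) ((M : ℂ) * (μ * φ x))).re
          = μ.re * (M * ‖φ x‖) ^ 2 := by
        have : inner ℂ ((M : ℂ) * φ x) ((M : ℂ) * (μ * φ x))
            = μ * (((M * ‖φ x‖) ^ 2 : ℝ) : ℂ) := by
          rw [RCLike.inner_apply]
          push_cast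
          rw [mul_pow, ← Complex.mul_conj' (φ x)]
          simp only [map_mul, Complex.conj_ofReal]
          ring
        rw [this, Complex.re_mul_ofReal]
      have hcross : (inner ℂ (L (π x)) (φ x • L (π (T v)))).re ≤ ‖L (π x)‖ * (‖φ x‖ * b) := by
        rw [hb, ← norm_smul]
        exact re_inner_le_norm (𝕜 := ℂ) _ _
      have hfst := hLα (π x)
      have hnorm : ‖(M : ℂ) * φ x‖ = M * ‖φ x‖ := by
        rw [norm_mul, Complex.norm_real, Real.norm_of_nonneg hM.le]
      have hinner : inner ℂ (L' x) (L' (T x)) = inner ℂ (L' x).fst (L' (T x)).fst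
          + inner ℂ (L' x).snd (L' (T x)).snd := WithLp.prod_inner_apply _ _
      rw [hinner, WithLp.prod_norm_sq_eq_of_L2, hL'1, hL'1, hL'2, hL'2, hφT, hπT, map_add,
        map_smul, inner_add_right, Complex.add_re, Complex.add_re, hsnd, hnorm]
      have h1 : ‖L (π x)‖ * (‖φ x‖ * b) ≤ ‖L (π x)‖ * (‖φ x‖ * (γ * M)) := by gcongr
      have h2 : μ.re * (M * ‖φ x‖) ^ 2 ≤ -γ * (M * ‖φ x‖) ^ 2 := by gcongr; linarith
      have h3 : -α * ‖L (π x)‖ ^ 2 ≤ -γ * ‖L (π x)‖ ^ 2 := by gcongr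
      nlinarith [mul_nonneg hγ.le (sq_nonneg (‖L (π x)‖ - M * ‖φ x‖))]

/-- A real matrix all of whose complex eigenvalues have negative real part is strictly dissipative
for the inner product pulled back along a suitable embedding. -/
theorem Matrix.exists_injective_inner_mulVec_le_neg {ι : Type*} [Fintype ι] [DecidableEq ι]
    (F : Matrix ι ι ℝ)
    (heig : ∀ μ : ℂ, (F.map (algebraMap ℝ ℂ)).charpoly.IsRoot μ → μ.re < 0) :
    ∃ (H : Type) (_ : NormedAddCommGroup H) (_ : InnerProductSpace ℝ H) (L : (ι → ℝ) →ₗ[ℝ] H)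
      (α : ℝ), Function.Injective L ∧ 0 < α ∧
        ∀ x, inner ℝ (L x) (L (F.mulVec x)) ≤ -α * ‖L x‖ ^ 2 := by
  obtain ⟨H, _, _, L, α, hL, hα, hLα⟩ :=
    Module.End.exists_injective_inner_le_neg (Matrix.toLin' (F.map (algebraMap ℝ ℂ)))
      (fun μ hμ ↦ heig μ (by
        rwa [Module.End.hasEigenvalue_iff_isRoot_charpoly, Matrix.charpoly_toLin'] at hμ))
  refine ⟨H, inferInstance, InnerProductSpace.complexToReal,
    (L.restrictScalars ℝ) ∘ₗ (Algebra.linearMap ℝ ℂ).compLeft ι, α, ?_, hα, fun x ↦ ?_⟩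
  · refine hL.comp fun x y hxy ↦ funext fun i ↦ ?_
    exact Complex.ofReal_injective (congrFun hxy i)
  · have hcomp : (Algebra.linearMap ℝ ℂ).compLeft ι (F.mulVec x)
        = Matrix.toLin' (F.map (algebraMap ℝ ℂ)) ((Algebra.linearMap ℝ ℂ).compLeft ι x) := by
      ext i
      simp [Matrix.mulVec, dotProduct]
    have h := hLα ((Algebra.linearMap ℝ ℂ).compLeft ι x)
    rw [← hcomp] at h
    rw [real_inner_eq_re_inner ℂ]
    exact h

/-- A strict dissipation inequality for the derivative of `f` at an equilibrium persists for `f`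
itself near the equilibrium. -/
theorem eventually_inner_le_neg_of_hasFDerivAt {E H : Type*} [NormedAddCommGroup E]
    [NormedSpace ℝ E] [NormedAddCommGroup H] [InnerProductSpace ℝ H] {f : E → E} {A : E →L[ℝ] E}
    (hf : HasFDerivAt f A 0) (hf0 : f 0 = 0) (L : E →L[ℝ] H) {K α : ℝ} (hK : 0 < K)
    (hLK : ∀ x, ‖x‖ ≤ K * ‖L x‖) (hα : 0 < α)
    (hA : ∀ x, inner ℝ (L x) (L (A x)) ≤ -α * ‖L x‖ ^ 2) :
    ∀ᶠ x in 𝓝 0, inner ℝ (L x) (L (f x)) ≤ -(α / 2) * ‖L x‖ ^ 2 := by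
  have hη : 0 < α / 2 / ((‖L‖ + 1) * K) := by positivity
  have ho := hf.isLittleO.def hη
  filter_upwards [ho] with x hx
  rw [hf0, sub_zero, sub_zero] at hx
  have hrem : ‖L (f x - A x)‖ ≤ α / 2 * ‖L x‖ :=
    calc ‖L (f x - A x)‖ ≤ ‖L‖ * ‖f x - A x‖ := L.le_opNorm _
      _ ≤ (‖L‖ + 1) * (α / 2 / ((‖L‖ + 1) * K) * (K * ‖L x‖)) := by
        gcongr
        · linarith
        · exact hx.trans (by gcongr; exact hLK x)
      _ = α / 2 * ‖L x‖ := by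
        have : ‖L‖ + 1 ≠ 0 := by positivity
        field_simp
  have hsplit : L (f x) = L (A x) + L (f x - A x) := by rw [← map_add]; congr 1; abel
  rw [hsplit, inner_add_right]
  have hcs := real_inner_le_norm (L x) (L (f x - A x))
  nlinarith [hA x, mul_le_mul_of_nonneg_left hrem (norm_nonneg (L x))]

/-- A function on `[0, ∞)` that satisfies `u' ≤ -α u` as long as it is below the threshold `R`, and
starts below it, decays exponentially. -/
theorem le_mul_exp_of_deriv_le_neg_mul {u u' : ℝ → ℝ} {α R b : ℝ}
    (hu : ∀ t ∈ Ici (0 : ℝ), HasDerivWithinAt u (u' t) (Ici 0) t) (hα : 0 < α)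
    (hu' : ∀ t ∈ Ici (0 : ℝ), u t < R → u' t ≤ -α * u t) (hb : 0 < b) (hbR : b < R)
    (hu0 : u 0 ≤ b) : ∀ t ∈ Ici (0 : ℝ), u t ≤ b * Real.exp (-(α / 2) * t) := by
  intro t ht
  refine image_le_of_deriv_right_lt_deriv_boundary (a := 0) (b := t) (f' := u')
    (B := fun s ↦ b * Real.exp (-(α / 2) * s))
    (B' := fun s ↦ b * (Real.exp (-(α / 2) * s) * (-(α / 2))))
    (fun s hs ↦ (hu s hs.1).continuousWithinAt.mono Icc_subset_Ici_self)
    (fun s hs ↦ (hu s hs.1).mono (Ici_subset_Ici.mpr hs.1)) (by simpa using hu0)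
    (fun s ↦ ?_) (fun s hs hus ↦ ?_) ⟨ht, le_rfl⟩
  · simpa using (((hasDerivAt_id s).const_mul (-(α / 2))).exp).const_mul b
  · have hpos : 0 < b * Real.exp (-(α / 2) * s) := by positivity
    have hle : b * Real.exp (-(α / 2) * s) ≤ b :=
      mul_le_of_le_one_right hb.le (Real.exp_le_one_iff.mpr (by nlinarith [hs.1]))
    have h := hu' s hs.1 (by linarith)
    rw [hus] at h
    nlinarith [mul_pos hα hpos]

/-- (Linearization, stable case.) If `f : D → ℝ^n` is continuously
differentiable with `f 0 = 0` and the Jacobian `F = Df(0)` has all its complex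
eigenvalues with negative real part, then the equilibrium `0` of `ẋ = f(x)` is
locally asymptotically stable. -/
theorem linearization_asymptotic_stability {n : ℕ}
    (D : Set (Fin n → ℝ)) (hD : IsOpen D) (hD0 : (0 : Fin n → ℝ) ∈ D)
    (f : (Fin n → ℝ) → (Fin n → ℝ)) (hf : ContDiffOn ℝ 1 f D) (hf0 : f 0 = 0)
    (F : Matrix (Fin n) (Fin n) ℝ)
    (hF : ∀ v : Fin n → ℝ, fderiv ℝ f 0 v = F.mulVec v)
    (heig : ∀ μ : ℂ, ((F.map (algebraMap ℝ ℂ)).charpoly.IsRoot μ) → μ.re < 0) :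
    (∀ ε > 0, ∃ δ > 0, ∀ x : ℝ → (Fin n → ℝ),
        (∀ t ∈ Ici (0 : ℝ), x t ∈ D ∧ HasDerivWithinAt x (f (x t)) (Ici 0) t) →
        ‖x 0‖ < δ → ∀ t ∈ Ici (0 : ℝ), ‖x t‖ < ε) ∧
    (∃ δ₀ > 0, ∀ x : ℝ → (Fin n → ℝ),
        (∀ t ∈ Ici (0 : ℝ), x t ∈ D ∧ HasDerivWithinAt x (f (x t)) (Ici 0) t) →
        ‖x 0‖ < δ₀ → Tendsto x atTop (𝓝 0)) := by
  obtain ⟨H, _, _, L₀, α, hL₀, hα, hLα⟩ := F.exists_injective_inner_mulVec_le_neg heig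
  obtain ⟨K, hK, hanti⟩ := L₀.injective_iff_antilipschitz.mp hL₀
  let L : (Fin n → ℝ) →L[ℝ] H := L₀.toContinuousLinearMap
  have hLK (x : Fin n → ℝ) : ‖x‖ ≤ K * ‖L x‖ := hanti.le_mul_norm (map_zero L₀) x
  have hK : 0 < (K : ℝ) := hK
  have hfd : HasFDerivAt f (fderiv ℝ f 0) 0 :=
    ((hf.contDiffAt (hD.mem_nhds hD0)).differentiableAt one_ne_zero).hasFDerivAt
  obtain ⟨r, hr, hball⟩ := Metric.eventually_nhds_iff.mp
    (eventually_inner_le_neg_of_hasFDerivAt hfd hf0 L hK hLK hα fun x ↦ by rw [hF]; exact hLα x)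
  have hdecay (b : ℝ) (hb : 0 < b) (hbr : b < (r / K) ^ 2) (x : ℝ → (Fin n → ℝ))
      (hx : ∀ t ∈ Ici (0 : ℝ), x t ∈ D ∧ HasDerivWithinAt x (f (x t)) (Ici 0) t)
      (hx0 : ‖L (x 0)‖ ^ 2 ≤ b) :
      ∀ t ∈ Ici (0 : ℝ), ‖L (x t)‖ ^ 2 ≤ b * Real.exp (-(α / 2) * t) := by
    refine le_mul_exp_of_deriv_le_neg_mul (u' := fun t ↦ 2 * inner ℝ (L (x t)) (L (f (x t))))
      (fun t ht ↦ ((L.hasFDerivAt.comp_hasDerivWithinAt t (hx t ht).2)).norm_sq) hα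
      (fun t ht hlt ↦ ?_) hb hbr hx0
    have hnorm : ‖L (x t)‖ < r / K := lt_of_pow_lt_pow_left₀ 2 (by positivity) hlt
    have := @hball (x t) (by
      rw [dist_zero_right]
      exact (hLK _).trans_lt (by rwa [lt_div_iff₀' hK] at hnorm))
    linarith
  have hstart (b : ℝ) (hb : 0 < b) : ∃ δ > 0, ∀ y : Fin n → ℝ, ‖y‖ < δ → ‖L y‖ ^ 2 ≤ b := by
    have hcont : Tendsto (fun y ↦ ‖L y‖ ^ 2) (𝓝 0) (𝓝 0) := by
      have : Continuous fun y ↦ ‖L y‖ ^ 2 := by fun_prop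
      simpa using this.tendsto 0
    obtain ⟨δ, hδ, h⟩ := Metric.eventually_nhds_iff.mp (hcont.eventually_le_const hb)
    exact ⟨δ, hδ, fun y hy ↦ h (by rwa [dist_zero_right])⟩
  constructor
  · intro ε hε
    obtain ⟨b, hb, hbm⟩ := exists_between
      (show 0 < min ((r / K) ^ 2) ((ε / K) ^ 2) by positivity)
    obtain ⟨δ, hδ, hδb⟩ := hstart b hb
    refine ⟨δ, hδ, fun x hx hx0 t ht ↦ (hLK _).trans_lt ?_⟩
    have h := hdecay b hb (hbm.trans_le (min_le_left _ _)) x hx (hδb _ hx0) t ht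
    have hle : b * Real.exp (-(α / 2) * t) ≤ b :=
      mul_le_of_le_one_right hb.le (Real.exp_le_one_iff.mpr (by nlinarith [mem_Ici.mp ht]))
    have hnorm : ‖L (x t)‖ < ε / K := lt_of_pow_lt_pow_left₀ 2 (by positivity)
      ((h.trans hle).trans_lt (hbm.trans_le (min_le_right _ _)))
    rwa [lt_div_iff₀' hK] at hnorm
  · obtain ⟨b, hb, hbr⟩ := exists_between (show 0 < (r / K) ^ 2 by positivity)
    obtain ⟨δ, hδ, hδb⟩ := hstart b hb
    refine ⟨δ, hδ, fun x hx hx0 ↦ ?_⟩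
    have hexp : Tendsto (fun t : ℝ ↦ b * Real.exp (-(α / 2) * t)) atTop (𝓝 0) := by
      have := (Real.tendsto_exp_atBot.comp
        (tendsto_id.const_mul_atTop_of_neg (show -(α / 2) < 0 by linarith))).const_mul b
      simpa using this
    have hsqrt : Tendsto (fun t : ℝ ↦ K * √(b * Real.exp (-(α / 2) * t))) atTop (𝓝 0) := by
      simpa using (hexp.sqrt).const_mul (K : ℝ)
    refine squeeze_zero_norm' ?_ hsqrt
    filter_upwards [eventually_ge_atTop 0] with t ht
    refine (hLK _).trans ?_
    gcongr
    exact Real.le_sqrt_of_sq_le (hdecay b hb hbr x hx (hδb _ hx0) t ht)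
end

section
/- Let F ∈ ℝ^{n×n} be a real matrix all of whose complex eigenvalues have nonpositive real part, with d the sum of algebraic multiplicities of the eigenvalues with zero real part and m = n − d. Then there exists an invertible real matrix T ∈ ℝ^{n×n} such that T⁻¹FT is block diagonal, T⁻¹FT = diag(F₁, F₂), where F₁ ∈ ℝ^{d×d} has all its complex eigenvalues with zero real part and F₂ ∈ ℝ^{m×m} has all its complex eigenvalues with negative real part. -/
open Matrix

/-- If a real polynomial is irreducible, then its complex roots all have the same real part. -/
lemma Irreducible.re_eq_re_of_aeval_eq_zero {q : Polynomial ℝ} (hq : Irreducible q) {z w : ℂ}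
    (hz : Polynomial.aeval z q = 0) (hw : Polynomial.aeval w q = 0) : z.re = w.re := by
  have h : IsConjRoot ℝ z w :=
    (minpoly.eq_of_irreducible hq hz).symm.trans (minpoly.eq_of_irreducible hq hw)
  have : IsAlgClosure ℝ ℂ := ⟨inferInstance, inferInstance⟩
  have : Normal ℝ ℂ := IsAlgClosure.normal ℝ ℂ
  obtain ⟨σ, rfl⟩ := isConjRoot_iff_exists_algEquiv.mp h
  rcases Complex.real_algHom_eq_id_or_conj (σ : ℂ →ₐ[ℝ] ℂ) with hσ | hσ
  · simpa using congrArg Complex.re (DFunLike.congr_fun hσ w)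
  · simpa using congrArg Complex.re (DFunLike.congr_fun hσ w)

/-- A nonzero real polynomial splits as a product according to a condition on the real parts
of its complex roots. -/
lemma Polynomial.exists_mul_eq_of_re (P : ℝ → Prop) {p : Polynomial ℝ} (hp : p ≠ 0) :
    ∃ q r : Polynomial ℝ, q * r = p ∧ (∀ z : ℂ, aeval z q = 0 → P z.re) ∧
      (∀ z : ℂ, aeval z r = 0 → ¬ P z.re) := by
  induction p using WfDvdMonoid.induction_on_irreducible with
  | zero => exact absurd rfl hp
  | unit u hu =>
    have hroot (z : ℂ) : aeval z u ≠ 0 := (hu.map (aeval z)).ne_zero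
    exact ⟨u, 1, mul_one u, fun z hz => absurd hz (hroot z), fun z hz => by simp at hz⟩
  | mul a i ha hi ih =>
    obtain ⟨q, r, rfl, hq, hr⟩ := ih ha
    by_cases h : ∃ z : ℂ, aeval z i = 0 ∧ P z.re
    · obtain ⟨w, hw, hPw⟩ := h
      refine ⟨i * q, r, mul_assoc _ _ _, fun z hz => ?_, hr⟩
      rw [map_mul, mul_eq_zero] at hz
      exact hz.elim (fun hz => hi.re_eq_re_of_aeval_eq_zero hw hz ▸ hPw) (hq z)
    · refine ⟨q, i * r, mul_left_comm _ _ _, hq, fun z hz hPz => ?_⟩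
      rw [map_mul, mul_eq_zero] at hz
      exact hz.elim (fun hz => h ⟨z, hz, hPz⟩) (fun hz => hr z hz hPz)

/-- The eigenvalues of a matrix, in an extension field, are roots of every polynomial which
annihilates the matrix. -/
lemma Matrix.aeval_eq_zero_of_isRoot_charpoly_map {ι K L : Type*} [Fintype ι] [DecidableEq ι]
    [Field K] [Field L] [Algebra K L] {A : Matrix ι ι K} {p : Polynomial K}
    (hp : Polynomial.aeval A p = 0) {μ : L}
    (hμ : (A.map (algebraMap K L)).charpoly.IsRoot μ) : Polynomial.aeval μ p = 0 := by
  have hA : Polynomial.aeval (A.map (algebraMap K L)) (p.map (algebraMap K L)) = 0 := by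
    rw [Polynomial.aeval_map_algebraMap]
    have h := Polynomial.aeval_algHom_apply ((Algebra.ofId K L).mapMatrix (m := ι)) A p
    rw [hp, map_zero] at h
    exact h
  have hmem := spectrum.subset_polynomial_aeval _ (p.map (algebraMap K L))
    ⟨μ, Matrix.mem_spectrum_of_isRoot_charpoly hμ, rfl⟩
  rw [hA] at hmem
  have : Nontrivial (Matrix ι ι L) := by
    by_contra hn
    rw [not_nontrivial_iff_subsingleton] at hn
    exact absurd hmem (by simp [spectrum.of_subsingleton])
  simpa [Polynomial.eval_map_algebraMap] using hmem

/-- Evaluating a polynomial commutes with restriction to an invariant submodule. -/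
lemma LinearMap.coe_aeval_restrict_apply {R M : Type*} [CommSemiring R] [AddCommMonoid M]
    [Module R M] {f : Module.End R M} {N : Submodule R M} (hN : ∀ x ∈ N, f x ∈ N)
    (p : Polynomial R) (x : N) :
    (Polynomial.aeval (f.restrict hN) p x : M) = Polynomial.aeval f p x := by
  induction p using Polynomial.induction_on' generalizing x with
  | add p q hp hq => simp [hp, hq]
  | monomial k a =>
    simp only [Polynomial.aeval_monomial, Module.End.mul_apply, Module.algebraMap_end_apply,
      Module.End.pow_restrict k hN,
      Submodule.coe_smul, LinearMap.coe_restrict_apply]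

/-- A square matrix annihilated by a product of coprime polynomials `p * q` is similar to a block
diagonal matrix whose blocks are annihilated by `p` and `q` respectively. -/
lemma Matrix.exists_fromBlocks_of_isCoprime {K : Type*} [Field K] {n : ℕ}
    (F : Matrix (Fin n) (Fin n) K) {p q : Polynomial K} (hpq : IsCoprime p q)
    (hF : Polynomial.aeval F (p * q) = 0) :
    ∃ (k l : ℕ) (h : k + l = n) (T : Matrix (Fin n) (Fin n) K)
      (A : Matrix (Fin k) (Fin k) K) (B : Matrix (Fin l) (Fin l) K),
      IsUnit T.det ∧
      T⁻¹ * F * T = Matrix.reindex (finSumFinEquiv.trans (finCongr h))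
        (finSumFinEquiv.trans (finCongr h)) (Matrix.fromBlocks A 0 0 B) ∧
      Polynomial.aeval A p = 0 ∧ Polynomial.aeval B q = 0 := by
  set f : Module.End K (Fin n → K) := Matrix.toLinAlgEquiv' F with hf
  have hker : Polynomial.aeval f (p * q) = 0 := by
    rw [hf, Polynomial.aeval_algHom_apply, hF, map_zero]
  set U := LinearMap.ker (Polynomial.aeval f p)
  set W := LinearMap.ker (Polynomial.aeval f q)
  have hUW : IsCompl U W := ⟨Polynomial.disjoint_ker_aeval_of_isCoprime f hpq, by
    rw [codisjoint_iff, Polynomial.sup_ker_aeval_eq_ker_aeval_mul_of_coprime f hpq, hker,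
      LinearMap.ker_zero]⟩
  have hinv (r : Polynomial K) : ∀ x ∈ LinearMap.ker (Polynomial.aeval f r),
      f x ∈ LinearMap.ker (Polynomial.aeval f r) := fun x hx => by
    have hcomm : Polynomial.aeval f r * f = f * Polynomial.aeval f r := by
      simpa using ((Commute.all r Polynomial.X).map (Polynomial.aeval f)).eq
    rw [LinearMap.mem_ker] at hx ⊢
    rw [← Module.End.mul_apply, hcomm, Module.End.mul_apply, hx, map_zero]
  have hrestrict (r : Polynomial K) : Polynomial.aeval (f.restrict (hinv r)) r = 0 := by
    ext1 x
    apply Subtype.ext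
    rw [LinearMap.coe_aeval_restrict_apply]
    exact x.2
  set bU := Module.finBasis K U
  set bW := Module.finBasis K W
  set e := U.prodEquivOfIsCompl W hUW
  have hdim : Module.finrank K U + Module.finrank K W = n := by
    simpa using Submodule.finrank_add_eq_of_isCompl hUW
  set σ := finSumFinEquiv.trans (finCongr hdim)
  set b := ((bU.prod bW).map e).reindex σ with hb
  set c := Pi.basisFun K (Fin n)
  have hfe (x : U × W) : f (e x) = e ((f.restrict (hinv p)).prodMap (f.restrict (hinv q)) x) := by
    simp [e]
  have hT : b.toMatrix c * c.toMatrix b = 1 := b.toMatrix_mul_toMatrix_flip c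
  refine ⟨_, _, hdim, c.toMatrix b, LinearMap.toMatrix bU bU (f.restrict (hinv p)),
    LinearMap.toMatrix bW bW (f.restrict (hinv q)), ?_, ?_, ?_, ?_⟩
  · exact Matrix.isUnit_det_of_left_inverse hT
  · have hFc : F = LinearMap.toMatrix c c f := by
      rw [LinearMap.toMatrix_eq_toMatrix']
      exact (LinearMap.toMatrix'_toLin' F).symm
    rw [Matrix.inv_eq_left_inv hT, hFc, basis_toMatrix_mul_linearMap_toMatrix_mul_basis_toMatrix,
      ← LinearMap.toMatrix_prodMap]
    have hblock (i j : Fin n) : LinearMap.toMatrix b b f i j =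
        LinearMap.toMatrix (bU.prod bW) (bU.prod bW)
          ((f.restrict (hinv p)).prodMap (f.restrict (hinv q))) (σ.symm i) (σ.symm j) := by
      simp [LinearMap.toMatrix_apply, hb, hfe]
    exact Matrix.ext hblock
  · change Polynomial.aeval (LinearMap.toMatrixAlgEquiv bU _) p = 0
    rw [Polynomial.aeval_algHom_apply, hrestrict, map_zero]
  · change Polynomial.aeval (LinearMap.toMatrixAlgEquiv bW _) q = 0
    rw [Polynomial.aeval_algHom_apply, hrestrict, map_zero]

/-- A real matrix whose complex eigenvalues all have nonpositive real
part is similar (over ℝ) to a block diagonal matrix `diag(F₁, F₂)` where all complex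
eigenvalues of `F₁` have zero real part and all complex eigenvalues of `F₂` have
negative real part; here `d` is the number of eigenvalues (with algebraic
multiplicity) with zero real part and `m = n - d`. -/
theorem block_diagonalization {n d m : ℕ} (F : Matrix (Fin n) (Fin n) ℝ)
    (heig : ∀ μ : ℂ, ((F.map (algebraMap ℝ ℂ)).charpoly.IsRoot μ) → μ.re ≤ 0)
    (hd : d = Multiset.card
      (((F.map (algebraMap ℝ ℂ)).charpoly.roots).filter (fun μ => μ.re = 0)))
    (hm : m = n - d) :
    ∃ (hdm : d + m = n) (T : Matrix (Fin n) (Fin n) ℝ)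
      (F₁ : Matrix (Fin d) (Fin d) ℝ) (F₂ : Matrix (Fin m) (Fin m) ℝ),
      IsUnit T.det ∧
      T⁻¹ * F * T =
        Matrix.reindex (finSumFinEquiv.trans (finCongr hdm))
          (finSumFinEquiv.trans (finCongr hdm)) (Matrix.fromBlocks F₁ 0 0 F₂) ∧
      (∀ μ : ℂ, ((F₁.map (algebraMap ℝ ℂ)).charpoly.IsRoot μ) → μ.re = 0) ∧
      (∀ μ : ℂ, ((F₂.map (algebraMap ℝ ℂ)).charpoly.IsRoot μ) → μ.re < 0) := by
  obtain ⟨p, q, hpq, hp, hq⟩ :=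
    Polynomial.exists_mul_eq_of_re (fun x => x = 0) F.charpoly_monic.ne_zero
  have hcop : IsCoprime p q := by
    refine (Polynomial.isCoprime_iff_aeval_ne_zero_of_isAlgClosed ℝ ℂ p q).mpr fun z => ?_
    by_contra! h
    exact hq z h.2 (hp z h.1)
  obtain ⟨k, l, hkl, T, F₁, F₂, hT, hTF, hF₁, hF₂⟩ :=
    F.exists_fromBlocks_of_isCoprime hcop (hpq ▸ F.aeval_self_charpoly)
  have hF₁re (μ : ℂ) (hμ : (F₁.map (algebraMap ℝ ℂ)).charpoly.IsRoot μ) : μ.re = 0 :=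
    hp μ (Matrix.aeval_eq_zero_of_isRoot_charpoly_map hF₁ hμ)
  have hF₂re (μ : ℂ) (hμ : (F₂.map (algebraMap ℝ ℂ)).charpoly.IsRoot μ) : μ.re ≠ 0 :=
    hq μ (Matrix.aeval_eq_zero_of_isRoot_charpoly_map hF₂ hμ)
  have hchar : (F.map (algebraMap ℝ ℂ)).charpoly =
      (F₁.map (algebraMap ℝ ℂ)).charpoly * (F₂.map (algebraMap ℝ ℂ)).charpoly := by
    have h : F.charpoly = F₁.charpoly * F₂.charpoly := by
      have hconj := Matrix.charpoly_units_conj' (Matrix.nonsingInvUnit T hT) F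
      change (T⁻¹ * F * T).charpoly = F.charpoly at hconj
      rw [← hconj, hTF, Matrix.charpoly_reindex, Matrix.charpoly_fromBlocks_zero₁₂]
    simp only [Matrix.charpoly_map, h, Polynomial.map_mul]
  have hcard : d = k := by
    have hne₁ := (F₁.map (algebraMap ℝ ℂ)).charpoly_monic.ne_zero
    have hne₂ := (F₂.map (algebraMap ℝ ℂ)).charpoly_monic.ne_zero
    rw [hd, hchar, Polynomial.roots_mul (mul_ne_zero hne₁ hne₂), Multiset.filter_add,
      Multiset.filter_eq_self.mpr fun μ hμ => hF₁re μ (Polynomial.isRoot_of_mem_roots hμ),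
      Multiset.filter_eq_nil.mpr fun μ hμ => hF₂re μ (Polynomial.isRoot_of_mem_roots hμ),
      add_zero, IsAlgClosed.card_roots_eq_natDegree, Matrix.charpoly_natDegree_eq_dim,
      Fintype.card_fin]
  obtain rfl : l = m := by omega
  subst hcard
  refine ⟨hkl, T, F₁, F₂, hT, hTF, hF₁re, fun μ hμ => lt_of_le_of_ne (heig μ ?_) (hF₂re μ hμ)⟩
  rw [hchar]
  exact Polynomial.root_mul_left_of_isRoot _ hμ
end

section
/- Let h : Ω → ℝ^m be a three times continuously differentiable solution of the center manifold PDE with h(0) = 0 and Dh(0) = 0, and suppose all eigenvalues of F₁ have zero real part and all eigenvalues of F₂ have negative real part. Then the degree-two homogeneous Taylor polynomial h^[2] of h at 0 satisfies, for all x ∈ ℝ^d, the algebraic equation Dh^[2](x)(F₁x) − F₂h^[2](x) = f̄₂^[2](x, 0), where f̄₂^[2](·,0) denotes the degree-two homogeneous Taylor polynomial at the origin of x ↦ f̄₂(x, 0). -/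
open Set Topology Filter Asymptotics

section SecondOrder

variable {E F : Type*} [NormedAddCommGroup E] [NormedSpace ℝ E]
  [NormedAddCommGroup F] [NormedSpace ℝ F]

/-- The quadratic form `z ↦ B(z, z) / 2` of a symmetric bilinear map has derivative `B x` at `x`. -/
theorem hasFDerivAt_half_smul_diag (B : E →L[ℝ] E →L[ℝ] F) (hB : ∀ v w, B v w = B w v) (x : E) :
    HasFDerivAt (fun z => (2 : ℝ)⁻¹ • B z z) (B x) x := by
  refine ((B.hasFDerivAt.clm_apply (hasFDerivAt_id x)).const_smul (2 : ℝ)⁻¹).congr_fderiv ?_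
  ext w
  simp [hB w x, ← two_smul ℝ, smul_smul]

/-- Second-order Taylor expansion at a point where the function and its derivative vanish. -/
theorem ContDiffAt.isLittleO_sub_half_fderiv_fderiv {g : E → F} (hg : ContDiffAt ℝ 2 g 0)
    (hg0 : g 0 = 0) (hDg0 : fderiv ℝ g 0 = 0) :
    (fun x => g x - (2 : ℝ)⁻¹ • fderiv ℝ (fderiv ℝ g) 0 x x) =o[𝓝 0] fun x => ‖x‖ ^ 2 := by
  have hsymm : ∀ v w, fderiv ℝ (fderiv ℝ g) 0 v w = fderiv ℝ (fderiv ℝ g) 0 w v :=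
    hg.isSymmSndFDerivAt (by simp)
  have hdiff : ∀ᶠ x in 𝓝 (0 : E), DifferentiableAt ℝ g x :=
    (hg.eventually (by simp)).mono fun x hx => hx.differentiableAt (by simp)
  obtain ⟨r, hr, hball⟩ := Metric.eventually_nhds_iff_ball.1 hdiff
  have hD : DifferentiableAt ℝ (fderiv ℝ g) 0 :=
    (hg.fderiv_right (m := 1) (by norm_num)).differentiableAt (by simp)
  have hlin : (fun x => fderiv ℝ g x - fderiv ℝ (fderiv ℝ g) 0 x)
      =o[𝓝[Metric.ball 0 r] 0] fun x => ‖x - 0‖ ^ 1 := by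
    have := hD.hasFDerivAt.isLittleO
    simp only [hDg0, sub_zero] at this
    simpa using (this.norm_right).mono nhdsWithin_le_nhds
  have key := (convex_ball (0 : E) r).isLittleO_pow_succ (Metric.mem_ball_self hr)
    (f := fun x => g x - (2 : ℝ)⁻¹ • fderiv ℝ (fderiv ℝ g) 0 x x)
    (fun x hx => ((hball x hx).hasFDerivAt.sub
      (hasFDerivAt_half_smul_diag _ hsymm x)).hasFDerivWithinAt) hlin
  rw [nhdsWithin_eq_nhds.2 (Metric.ball_mem_nhds _ hr)] at key
  simpa [hg0] using key

/-- Along a ray, `g (t v) / t²` tends to the degree-two Taylor term of `g`. -/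
theorem ContDiffAt.tendsto_inv_sq_smul {g : E → F} (hg : ContDiffAt ℝ 2 g 0)
    (hg0 : g 0 = 0) (hDg0 : fderiv ℝ g 0 = 0) (v : E) :
    Tendsto (fun t : ℝ => (t ^ 2)⁻¹ • g (t • v)) (𝓝[≠] 0)
      (𝓝 ((2 : ℝ)⁻¹ • fderiv ℝ (fderiv ℝ g) 0 v v)) := by
  have hray : Tendsto (fun t : ℝ => t • v) (𝓝[≠] 0) (𝓝 0) :=
    ((continuous_id.smul continuous_const).tendsto' _ _ (by simp)).mono_left nhdsWithin_le_nhds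
  have hlit : (fun t : ℝ => g (t • v) - (2 : ℝ)⁻¹ • fderiv ℝ (fderiv ℝ g) 0 (t • v) (t • v))
      =o[𝓝[≠] 0] fun t : ℝ => t ^ 2 := by
    refine ((hg.isLittleO_sub_half_fderiv_fderiv hg0 hDg0).comp_tendsto hray).trans_isBigO ?_
    refine IsBigO.of_bound (‖v‖ ^ 2) (Eventually.of_forall fun t => ?_)
    simp [norm_smul, mul_pow, mul_comm]
  refine tendsto_sub_nhds_zero_iff.1 (hlit.tendsto_inv_smul_nhds_zero.congr' ?_)
  filter_upwards [self_mem_nhdsWithin] with t ht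
  have ht' : t ≠ 0 := ht
  simp only [smul_sub, map_smul, smul_apply, smul_smul]
  congr 2
  field_simp

/-- Difference quotients along a ray at a zero of the function. -/
theorem HasFDerivAt.tendsto_inv_smul_ray {g : E → F} {g' : E →L[ℝ] F} (hg : HasFDerivAt g g' 0)
    (hg0 : g 0 = 0) (v : E) :
    Tendsto (fun t : ℝ => t⁻¹ • g (t • v)) (𝓝[≠] 0) (𝓝 (g' v)) := by
  simpa [hg0] using (hg.hasLineDerivAt v).tendsto_slope_zero

end SecondOrder



/-- If `h` is a `C³` solution of the center manifold PDE with
`h 0 = 0` and `Dh 0 = 0`, then the degree-two homogeneous Taylor term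
`h^[2](x) = (1/2) D²h(0)[x,x]` satisfies the algebraic equation
`Dh^[2](x)(F₁x) − F₂ h^[2](x) = f̄₂^[2](x,0)`, where `f̄₂^[2](·,0)` is the
degree-two homogeneous Taylor term at `0` of `x ↦ f̄₂(x,0)`. -/
theorem degree_two_taylor_equation {d m : ℕ}
    (F₁ : Matrix (Fin d) (Fin d) ℝ) (F₂ : Matrix (Fin m) (Fin m) ℝ)
    (hF₁ : ∀ μ : ℂ, ((F₁.map (algebraMap ℝ ℂ)).charpoly.IsRoot μ) → μ.re = 0)
    (hF₂ : ∀ μ : ℂ, ((F₂.map (algebraMap ℝ ℂ)).charpoly.IsRoot μ) → μ.re < 0)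
    (f₁ : (Fin d → ℝ) → (Fin m → ℝ) → (Fin d → ℝ))
    (f₂ : (Fin d → ℝ) → (Fin m → ℝ) → (Fin m → ℝ))
    (hf₁ : ContDiff ℝ 3 (fun p : (Fin d → ℝ) × (Fin m → ℝ) => f₁ p.1 p.2))
    (hf₂ : ContDiff ℝ 3 (fun p : (Fin d → ℝ) × (Fin m → ℝ) => f₂ p.1 p.2))
    (hf₁0 : f₁ 0 0 = 0) (hf₂0 : f₂ 0 0 = 0)
    (hDf₁0 : fderiv ℝ (fun p : (Fin d → ℝ) × (Fin m → ℝ) => f₁ p.1 p.2) (0, 0) = 0)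
    (hDf₂0 : fderiv ℝ (fun p : (Fin d → ℝ) × (Fin m → ℝ) => f₂ p.1 p.2) (0, 0) = 0)
    (Ω : Set (Fin d → ℝ)) (hΩopen : IsOpen Ω) (hΩ0 : 0 ∈ Ω)
    (h : (Fin d → ℝ) → (Fin m → ℝ)) (hh : ContDiffOn ℝ 3 h Ω)
    (hh0 : h 0 = 0) (hDh0 : fderiv ℝ h 0 = 0)
    (hpde : ∀ x ∈ Ω, fderiv ℝ h x (F₁.mulVec x + f₁ x (h x)) =
      F₂.mulVec (h x) + f₂ x (h x)) :
    ∀ x : Fin d → ℝ,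
      fderiv ℝ (fun z : Fin d → ℝ =>
          (2 : ℝ)⁻¹ • iteratedFDeriv ℝ 2 h 0 (fun _ => z)) x (F₁.mulVec x)
        - F₂.mulVec ((2 : ℝ)⁻¹ • iteratedFDeriv ℝ 2 h 0 (fun _ => x))
      = (2 : ℝ)⁻¹ • iteratedFDeriv ℝ 2 (fun z : Fin d → ℝ => f₂ z 0) 0
          (fun _ => x) := by
  intro x
  have hh3 : ContDiffAt ℝ 3 h 0 := hh.contDiffAt (hΩopen.mem_nhds hΩ0)
  have hh2 : ContDiffAt ℝ 2 h 0 := hh3.of_le (by norm_num)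
  have hhd : HasFDerivAt h 0 0 := hDh0 ▸ (hh2.differentiableAt (by simp)).hasFDerivAt
  have hDhd : HasFDerivAt (fderiv ℝ h) (fderiv ℝ (fderiv ℝ h) 0) 0 :=
    ((hh2.fderiv_right (m := 1) (by norm_num)).differentiableAt (by simp)).hasFDerivAt
  have hf₁d : HasFDerivAt (fun p : (Fin d → ℝ) × (Fin m → ℝ) => f₁ p.1 p.2) 0 (0, 0) :=
    hDf₁0 ▸ (hf₁.differentiable (by simp) _).hasFDerivAt
  have hf₂s : HasStrictFDerivAt (fun p : (Fin d → ℝ) × (Fin m → ℝ) => f₂ p.1 p.2) 0 (0, 0) :=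
    hDf₂0 ▸ hf₂.contDiffAt.hasStrictFDerivAt (by simp)
  have hg : ContDiff ℝ 2 (fun z : Fin d → ℝ => f₂ z 0) :=
    (hf₂.of_le (by norm_num)).comp (contDiff_id.prodMk contDiff_const)
  have hDg : fderiv ℝ (fun z : Fin d → ℝ => f₂ z 0) 0 = 0 := by
    have hslice : HasFDerivAt (fun z : Fin d → ℝ => (z, (0 : Fin m → ℝ)))
        ((ContinuousLinearMap.id ℝ (Fin d → ℝ)).prod 0) 0 :=
      (hasFDerivAt_id _).prodMk (hasFDerivAt_const _ _)
    simpa [Function.comp_def] using (hf₂s.hasFDerivAt.comp (0 : Fin d → ℝ) hslice).fderiv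
  have hf₁h : HasFDerivAt (fun z => f₁ z (h z)) (0 : (Fin d → ℝ) →L[ℝ] (Fin d → ℝ)) 0 := by
    have hgraph : HasFDerivAt (fun z => (z, h z))
        ((ContinuousLinearMap.id ℝ (Fin d → ℝ)).prod 0) 0 := (hasFDerivAt_id _).prodMk hhd
    rw [← hh0] at hf₁d
    simpa [Function.comp_def] using hf₁d.comp (0 : Fin d → ℝ) hgraph
  have hray : Tendsto (fun t : ℝ => t • x) (𝓝[≠] 0) (𝓝 0) :=
    ((continuous_id.smul continuous_const).tendsto' _ _ (by simp)).mono_left nhdsWithin_le_nhds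
  have hhlim := hh2.tendsto_inv_sq_smul hh0 hDh0 x
  have hglim := hg.contDiffAt.tendsto_inv_sq_smul hf₂0 hDg x
  have hhO : (fun t : ℝ => h (t • x)) =O[𝓝[≠] 0] fun t : ℝ => t ^ 2 := by
    have := (isBigO_refl (fun t : ℝ => t ^ 2) (𝓝[≠] 0)).smul (hhlim.isBigO_one ℝ)
    refine (this.congr' ?_ (by simp))
    filter_upwards [self_mem_nhdsWithin] with t ht
    exact smul_inv_smul₀ (pow_ne_zero 2 ht) _
  have hremainder : Tendsto (fun t : ℝ => (t ^ 2)⁻¹ • (f₂ (t • x) (h (t • x)) - f₂ (t • x) 0))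
      (𝓝[≠] 0) (𝓝 0) := by
    have hh_ray : Tendsto (fun t : ℝ => h (t • x)) (𝓝[≠] 0) (𝓝 0) :=
      (hh0 ▸ hhd.continuousAt.tendsto : Tendsto h (𝓝 0) (𝓝 0)).comp hray
    have hpts : Tendsto (fun t : ℝ => ((t • x, h (t • x)), (t • x, (0 : Fin m → ℝ)))) (𝓝[≠] 0)
        (𝓝 (((0 : Fin d → ℝ), (0 : Fin m → ℝ)), ((0 : Fin d → ℝ), (0 : Fin m → ℝ)))) :=
      (hray.prodMk_nhds hh_ray).prodMk_nhds (hray.prodMk_nhds tendsto_const_nhds)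
    have hlit := hf₂s.isLittleO.comp_tendsto hpts
    refine IsLittleO.tendsto_inv_smul_nhds_zero (IsLittleO.trans_isBigO ?_ hhO)
    refine (hlit.congr_left fun t => by simp).trans_isBigO (isBigO_of_le _ fun t => ?_)
    simp [Prod.norm_def]
  have hleft : Tendsto (fun t : ℝ => (t⁻¹ • fderiv ℝ h (t • x))
      (F₁.mulVec x + t⁻¹ • f₁ (t • x) (h (t • x)))) (𝓝[≠] 0)
      (𝓝 (fderiv ℝ (fderiv ℝ h) 0 x (F₁.mulVec x))) := by
    have hf₁lim := hf₁h.tendsto_inv_smul_ray (by simpa [hh0] using hf₁0) x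
    simpa [Function.comp_def] using (isBoundedBilinearMap_apply.continuous.tendsto _).comp
      ((hDhd.tendsto_inv_smul_ray hDh0 x).prodMk_nhds (hf₁lim.const_add (F₁.mulVec x)))
  have hright : Tendsto (fun t : ℝ => F₂.mulVec ((t ^ 2)⁻¹ • h (t • x)) +
      ((t ^ 2)⁻¹ • (f₂ (t • x) (h (t • x)) - f₂ (t • x) 0) + (t ^ 2)⁻¹ • f₂ (t • x) 0)) (𝓝[≠] 0)
      (𝓝 (F₂.mulVec ((2 : ℝ)⁻¹ • fderiv ℝ (fderiv ℝ h) 0 x x) +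
        (0 + (2 : ℝ)⁻¹ • fderiv ℝ (fderiv ℝ fun z : Fin d → ℝ => f₂ z 0) 0 x x))) :=
    (((continuous_const.matrix_mulVec continuous_id).tendsto _).comp hhlim).add
      (hremainder.add hglim)
  have hlimits := tendsto_nhds_unique_of_eventuallyEq hleft hright <| by
    filter_upwards [self_mem_nhdsWithin, hray (hΩopen.mem_nhds hΩ0)] with t ht htΩ
    have ht' : t ≠ 0 := ht
    have hscale : F₁.mulVec x + t⁻¹ • f₁ (t • x) (h (t • x)) =
        t⁻¹ • (F₁.mulVec (t • x) + f₁ (t • x) (h (t • x))) := by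
      rw [Matrix.mulVec_smul, smul_add, inv_smul_smul₀ ht']
    rw [hscale, map_smul, smul_apply, hpde _ htΩ, smul_smul, ← smul_add,
      sub_add_cancel, Matrix.mulVec_smul, ← smul_add, sq, mul_inv]
  have hquad := hasFDerivAt_half_smul_diag _ (hh2.isSymmSndFDerivAt (by simp)) x
  simp only [iteratedFDeriv_two_apply]
  rw [hquad.fderiv, hlimits, zero_add, add_sub_cancel_left]
end

section
/- Suppose all complex eigenvalues of F₁ ∈ ℝ^{d×d} have zero real part and all complex eigenvalues of F₂ ∈ ℝ^{m×m} have negative real part. Then for every integer k ≥ 2 and every ℝ^m-valued homogeneous polynomial q of degree k on ℝ^d, there exists a unique ℝ^m-valued homogeneous polynomial p of degree k on ℝ^d satisfying Dp(x)(F₁x) − F₂p(x) = q(x) for all x ∈ ℝ^d; that is, the linear operator p ↦ Dp(·)(F₁·) − F₂p(·) on the space of ℝ^m-valued degree-k homogeneous polynomials is invertible. -/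
open Finset MvPolynomial

open Module

/-- A generalized eigenvector of eigenvalue `a` times one of eigenvalue `b` is, for a derivation,
a generalized eigenvector of eigenvalue `a + b`. -/
lemma Derivation.mul_mem_maxGenEigenspace {K A : Type*} [CommRing K] [CommRing A] [Algebra K A]
    (D : Derivation K A A) {a b : K} {x y : A}
    (hx : x ∈ End.maxGenEigenspace (D : A →ₗ[K] A) a)
    (hy : y ∈ End.maxGenEigenspace (D : A →ₗ[K] A) b) :
    x * y ∈ End.maxGenEigenspace (D : A →ₗ[K] A) (a + b) := by
  rw [End.mem_maxGenEigenspace] at hx hy ⊢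
  obtain ⟨r, hr⟩ := hx
  obtain ⟨s, hs⟩ := hy
  refine ⟨r + s, ?_⟩
  induction hN : r + s generalizing r s x y with
  | zero =>
    obtain ⟨rfl, rfl⟩ : r = 0 ∧ s = 0 := by omega
    have hx0 : x = 0 := by simpa using hr
    simp [hx0]
  | succ N ih =>
    rcases r with _ | r
    · have hx0 : x = 0 := by simpa using hr
      simp [hx0]
    rcases s with _ | s
    · have hy0 : y = 0 := by simpa using hs
      simp [hy0]
    have leibniz : ((D : End K A) - (a + b) • 1) (x * y) =
        ((D : End K A) - a • 1) x * y + x * ((D : End K A) - b • 1) y := by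
      simp only [LinearMap.sub_apply, LinearMap.smul_apply, End.one_apply, Derivation.coeFn_coe,
        Derivation.leibniz, smul_eq_mul, add_smul, LinearMap.add_apply, sub_mul, mul_sub,
        smul_mul_assoc, mul_smul_comm, mul_comm y]
      abel
    rw [pow_succ, End.mul_apply, leibniz, map_add,
      ih r (by rwa [pow_succ, End.mul_apply] at hr) (s + 1) hs (by omega),
      ih (r + 1) hr s (by rwa [pow_succ, End.mul_apply] at hs) (by omega), add_zero]

/-- The generalized eigenvectors of a derivation with eigenvalues in an additive submonoid
form a multiplicative submonoid. -/
def Derivation.genEigenvectors {K A : Type*} [CommRing K] [CommRing A] [Algebra K A]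
    (D : Derivation K A A) (S : AddSubmonoid K) : Submonoid A where
  carrier := {x | ∃ a ∈ S, x ∈ End.maxGenEigenspace (D : A →ₗ[K] A) a}
  one_mem' := ⟨0, S.zero_mem, (End.mem_maxGenEigenspace _ _ _).2 ⟨1, by simp⟩⟩
  mul_mem' := by
    rintro x y ⟨a, ha, hx⟩ ⟨b, hb, hy⟩
    exact ⟨a + b, S.add_mem ha hb, D.mul_mem_maxGenEigenspace hx hy⟩

/-- If generators of an algebra are sums of generalized eigenvectors of a derivation with
eigenvalues in an additive submonoid, then so is every element. -/
lemma Derivation.span_genEigenvectors_eq_top {K A : Type*} [CommRing K] [CommRing A] [Algebra K A]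
    (D : Derivation K A A) (S : AddSubmonoid K) {s : Set A} (hs : Algebra.adjoin K s = ⊤)
    (h : s ⊆ Submodule.span K (D.genEigenvectors S : Set A)) :
    Submodule.span K (D.genEigenvectors S : Set A) = ⊤ := by
  have hspan := Algebra.adjoin_eq_span K (D.genEigenvectors S : Set A)
  rw [Submonoid.closure_eq] at hspan
  rw [← hspan, Algebra.toSubmodule_eq_top, eq_top_iff, ← hs, Algebra.adjoin_le_iff]
  intro x hx
  rw [SetLike.mem_coe, ← Subalgebra.mem_toSubmodule, hspan]
  exact h hx

/-- A vector in the span of generalized eigenvectors is annihilated by a polynomial whose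
roots are eigenvalues of these vectors. -/
lemma Module.End.exists_aeval_eq_zero_of_mem_span {K V : Type*} [Field K] [AddCommGroup V]
    [Module K V] (f : End K V) (S : Set K) {v : V}
    (hv : v ∈ Submodule.span K {x | ∃ a ∈ S, x ∈ f.maxGenEigenspace a}) :
    ∃ g : Polynomial K, (∀ a, g.IsRoot a → a ∈ S) ∧ Polynomial.aeval f g v = 0 := by
  induction hv using Submodule.span_induction with
  | mem x hx =>
    obtain ⟨a, ha, hx⟩ := hx
    obtain ⟨n, hn⟩ := (End.mem_maxGenEigenspace _ _ _).1 hx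
    refine ⟨(Polynomial.X - Polynomial.C a) ^ n, fun b hb ↦ ?_, ?_⟩
    · have hba : b - a = 0 := by
        rw [Polynomial.IsRoot.def, Polynomial.eval_pow] at hb
        simpa using eq_zero_of_pow_eq_zero hb
      rwa [sub_eq_zero.1 hba]
    · simpa [Algebra.algebraMap_eq_smul_one] using hn
  | zero => exact ⟨1, by simp, by simp⟩
  | add x y _ _ hx hy =>
    obtain ⟨g, hg, hgx⟩ := hx
    obtain ⟨h, hh, hhy⟩ := hy
    refine ⟨g * h, fun a ha ↦ ?_, ?_⟩
    · rcases Polynomial.root_mul.1 ha with ha | ha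
      exacts [hg a ha, hh a ha]
    · have hx : Polynomial.aeval f (g * h) x = 0 := by
        rw [mul_comm, map_mul, End.mul_apply, hgx, map_zero]
      have hy : Polynomial.aeval f (g * h) y = 0 := by
        rw [map_mul, End.mul_apply, hhy, map_zero]
      rw [map_add, hx, hy, add_zero]
  | smul c x _ hx =>
    obtain ⟨g, hg, hgx⟩ := hx
    exact ⟨g, hg, by rw [map_smul, hgx, smul_zero]⟩

/-- If an endomorphism acts on a finite family through a matrix, then so do polynomials in it. -/
lemma Module.End.aeval_apply_of_apply_eq_sum {K V ι : Type*} [CommRing K] [AddCommGroup V]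
    [Module K V] [Fintype ι] [DecidableEq ι] (f : End K V) (B : Matrix ι ι K) (v : ι → V)
    (h : ∀ i, f (v i) = ∑ j, B i j • v j) (g : Polynomial K) (i : ι) :
    Polynomial.aeval f g (v i) = ∑ j, Polynomial.aeval B g i j • v j := by
  induction g using Polynomial.induction_on generalizing i with
  | C a => simp [Matrix.algebraMap_matrix_apply, ite_smul]
  | add p q hp hq => simp [hp, hq, add_smul, Finset.sum_add_distrib]
  | monomial n a ih =>
    have hf : Polynomial.aeval f (Polynomial.C a * Polynomial.X ^ (n + 1)) (v i) =
        Polynomial.aeval f (Polynomial.C a * Polynomial.X ^ n) (f (v i)) := by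
      rw [pow_succ, ← mul_assoc, map_mul, Polynomial.aeval_X, End.mul_apply]
    have hB : Polynomial.aeval B (Polynomial.C a * Polynomial.X ^ (n + 1)) =
        B * Polynomial.aeval B (Polynomial.C a * Polynomial.X ^ n) := by
      rw [pow_succ', mul_left_comm, map_mul, Polynomial.aeval_X]
    rw [hf, hB, h, map_sum]
    simp_rw [map_smul, ih, Matrix.mul_apply, Finset.sum_smul, Finset.smul_sum, smul_smul]
    exact Finset.sum_comm

namespace MvPolynomial

variable {σ K : Type*} [Fintype σ]

/-- The derivative along the linear vector field `x ↦ A x`. -/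
noncomputable def linearDerivation [CommRing K] (A : Matrix σ σ K) :
    Derivation K (MvPolynomial σ K) (MvPolynomial σ K) :=
  mkDerivation K fun j ↦ ∑ i, A j i • X i

lemma linearDerivation_apply [CommRing K] (A : Matrix σ σ K) (p : MvPolynomial σ K) :
    linearDerivation A p = ∑ j, (∑ i, A j i • X i) * pderiv j p := by
  classical
  have h : linearDerivation A = ∑ j, (∑ i, A j i • X i : MvPolynomial σ K) • pderiv j := by
    refine derivation_ext fun i ↦ ?_
    rw [linearDerivation, mkDerivation_X, ← Derivation.coeFnAddMonoidHom_apply, map_sum,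
      Finset.sum_apply]
    simp [pderiv_X, Pi.single_apply]
  rw [h, ← Derivation.coeFnAddMonoidHom_apply, map_sum, Finset.sum_apply]
  simp

lemma eval_linearDerivation [CommRing K] (A : Matrix σ σ K) (p : MvPolynomial σ K) (x : σ → K) :
    eval x (linearDerivation A p) = ∑ j, A.mulVec x j * eval x (pderiv j p) := by
  simp [linearDerivation_apply, Matrix.mulVec, dotProduct, smul_eval]

lemma map_linearDerivation [CommRing K] {L : Type*} [CommRing L] (φ : K →+* L)
    (A : Matrix σ σ K) (p : MvPolynomial σ K) :
    map φ (linearDerivation A p) = linearDerivation (A.map φ) (map φ p) := by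
  simp [linearDerivation_apply, pderiv_map, smul_eq_C_mul]

lemma IsHomogeneous.linearDerivation [CommRing K] (A : Matrix σ σ K) {p : MvPolynomial σ K} {k : ℕ}
    (hp : p.IsHomogeneous k) : (linearDerivation A p).IsHomogeneous k := by
  rw [linearDerivation_apply]
  refine IsHomogeneous.sum _ _ _ fun j _ ↦ ?_
  rcases k with _ | k
  · rw [← totalDegree_zero_iff_isHomogeneous, totalDegree_eq_zero_iff_eq_C] at hp
    rw [hp, pderiv_C, mul_zero]
    exact isHomogeneous_zero _ _ _
  · rw [add_comm]
    refine IsHomogeneous.mul (IsHomogeneous.sum _ _ _ fun i _ ↦ ?_) hp.pderiv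
    rw [smul_eq_C_mul]
    exact isHomogeneous_C_mul_X _ _

/-- All polynomials are sums of generalized eigenvectors of the derivative along a linear
vector field, with eigenvalues in any additive submonoid containing those of its matrix. -/
lemma span_genEigenvectors_linearDerivation [Field K] [IsAlgClosed K] [DecidableEq σ]
    (A : Matrix σ σ K) (S : AddSubmonoid K) (hA : ∀ a, A.charpoly.IsRoot a → a ∈ S) :
    Submodule.span K ((linearDerivation A).genEigenvectors S : Set (MvPolynomial σ K)) = ⊤ := by
  refine Derivation.span_genEigenvectors_eq_top _ _ (adjoin_range_X (R := K) (σ := σ)) ?_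
  let ℓ : (σ → K) →ₗ[K] MvPolynomial σ K := Fintype.linearCombination K X
  let f : End K (σ → K) := Matrix.toLin' A.transpose
  let D : End K (MvPolynomial σ K) := (linearDerivation A : _ →ₗ[K] _)
  have comm (a : K) (v : σ → K) : (D - a • 1) (ℓ v) = ℓ ((f - a • 1) v) := by
    have hD : D (ℓ v) = ℓ (f v) := by
      simp only [D, ℓ, f, Fintype.linearCombination_apply, map_sum, map_smul,
        Derivation.coeFn_coe, linearDerivation, mkDerivation_X, Matrix.toLin'_apply,
        Matrix.mulVec, dotProduct, Matrix.transpose_apply, Finset.smul_sum, Finset.sum_smul,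
        smul_smul]
      rw [Finset.sum_comm]
      simp only [mul_comm]
    simp [hD]
  have comm_pow (a : K) (n : ℕ) (v : σ → K) :
      ((D - a • 1) ^ n) (ℓ v) = ℓ (((f - a • 1) ^ n) v) := by
    induction n generalizing v with
    | zero => simp
    | succ n ih => rw [pow_succ, pow_succ, End.mul_apply, End.mul_apply, comm, ih]
  have key : (⊤ : Submodule K (σ → K)) ≤ (Submodule.span K
      ((linearDerivation A).genEigenvectors S : Set (MvPolynomial σ K))).comap ℓ := by
    rw [← End.iSup_maxGenEigenspace_eq_top f, iSup_le_iff]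
    intro a v hv
    by_cases hv0 : v = 0
    · simp [hv0]
    have htop : f.HasUnifEigenvalue a ⊤ := by
      intro h
      rw [End.maxGenEigenspace, h, Submodule.mem_bot] at hv
      exact hv0 hv
    have ha : f.HasEigenvalue a := htop.lt one_pos
    have hroot : A.charpoly.IsRoot a := by
      rw [← Matrix.charpoly_transpose, ← Matrix.charpoly_toLin']
      exact (End.hasEigenvalue_iff_isRoot_charpoly f a).1 ha
    obtain ⟨n, hn⟩ := (End.mem_maxGenEigenspace _ _ _).1 hv
    refine Submodule.subset_span ⟨a, hA a hroot, (End.mem_maxGenEigenspace _ _ _).2 ⟨n, ?_⟩⟩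
    exact (comm_pow a n v).trans (by rw [hn, map_zero])
  rintro _ ⟨i, rfl⟩
  simpa [ℓ, Fintype.linearCombination_apply_single] using
    key (Submodule.mem_top (x := Pi.single i 1))

/-- A family of polynomials on which the derivative along `A` acts through a matrix `B` vanishes,
provided no eigenvalue of `B` lies in an additive submonoid containing those of `A`. -/
lemma eq_zero_of_linearDerivation_eq_sum [Field K] [IsAlgClosed K] [DecidableEq σ] {ι : Type*}
    [Fintype ι] [DecidableEq ι] (A : Matrix σ σ K) (B : Matrix ι ι K) (S : AddSubmonoid K)
    (hA : ∀ a, A.charpoly.IsRoot a → a ∈ S) (hB : ∀ b, B.charpoly.IsRoot b → b ∉ S)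
    (p : ι → MvPolynomial σ K) (hp : ∀ i, linearDerivation A (p i) = ∑ j, B i j • p j) :
    p = 0 := by
  funext i
  let D : End K (MvPolynomial σ K) := (linearDerivation A : _ →ₗ[K] _)
  obtain ⟨g, hg, hgp⟩ := End.exists_aeval_eq_zero_of_mem_span D S (v := p i) <| by
    change p i ∈ Submodule.span K ((linearDerivation A).genEigenvectors S : Set _)
    simp [span_genEigenvectors_linearDerivation A S hA]
  have hBp : Polynomial.aeval D B.charpoly (p i) = 0 := by
    rw [End.aeval_apply_of_apply_eq_sum D B p hp, Matrix.aeval_self_charpoly]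
    simp
  have hcop : IsCoprime g B.charpoly := by
    rw [Polynomial.isCoprime_iff_aeval_ne_zero_of_isAlgClosed K K]
    intro a
    by_contra! h
    exact hB a (by simpa using h.2) (hg a (by simpa using h.1))
  obtain ⟨u, w, huw⟩ := hcop
  have := congrArg (fun r ↦ Polynomial.aeval D r (p i)) huw
  simpa [hgp, hBp] using this.symm

end MvPolynomial

/-- A family of real polynomials on which the derivative along `A` acts through a matrix `B`
vanishes, if the spectrum of `A` is imaginary and that of `B` lies in the left half-plane. -/
lemma MvPolynomial.eq_zero_of_linearDerivation_eq_sum_of_re {σ ι : Type*} [Fintype σ]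
    [DecidableEq σ] [Fintype ι] [DecidableEq ι] (A : Matrix σ σ ℝ) (B : Matrix ι ι ℝ)
    (hA : ∀ μ : ℂ, ((A.map (algebraMap ℝ ℂ)).charpoly.IsRoot μ) → μ.re = 0)
    (hB : ∀ μ : ℂ, ((B.map (algebraMap ℝ ℂ)).charpoly.IsRoot μ) → μ.re < 0)
    (p : ι → MvPolynomial σ ℝ) (hp : ∀ i, linearDerivation A (p i) = ∑ j, B i j • p j) :
    p = 0 := by
  have hmap := eq_zero_of_linearDerivation_eq_sum (A.map (algebraMap ℝ ℂ))
    (B.map (algebraMap ℝ ℂ)) (AddMonoidHom.mker Complex.reAddGroupHom) hA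
    (fun b hb h ↦ (hB b hb).ne h) (fun i ↦ map (algebraMap ℝ ℂ) (p i)) fun i ↦ by
      rw [← map_linearDerivation, hp]
      simp [smul_eq_C_mul]
  funext i
  exact map_injective _ (algebraMap ℝ ℂ).injective (by simpa using congrFun hmap i)

/-- The homological operator `p ↦ Dp(·)(A·) − B p(·)`. -/
noncomputable def MvPolynomial.homologicalOperator {σ ι K : Type*} [Fintype σ] [Fintype ι]
    [CommRing K] (A : Matrix σ σ K) (B : Matrix ι ι K) :
    (ι → MvPolynomial σ K) →ₗ[K] (ι → MvPolynomial σ K) :=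
  LinearMap.pi fun i ↦ (linearDerivation A : _ →ₗ[K] _) ∘ₗ LinearMap.proj i
    - ∑ l, B i l • LinearMap.proj l

lemma MvPolynomial.homologicalOperator_apply {σ ι K : Type*} [Fintype σ] [Fintype ι]
    [CommRing K] (A : Matrix σ σ K) (B : Matrix ι ι K) (p : ι → MvPolynomial σ K) (i : ι) :
    homologicalOperator A B p i = linearDerivation A (p i) - ∑ l, B i l • p l := by
  simp [homologicalOperator]

/-- If all complex eigenvalues of `F₁` have zero real part and all
complex eigenvalues of `F₂` have negative real part, then for every `k ≥ 2` the
homological operator `p ↦ Dp(·)(F₁·) − F₂p(·)` is invertible on the space of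
`ℝ^m`-valued homogeneous polynomials of degree `k` on `ℝ^d`: for every homogeneous
`q` of degree `k` there is a unique homogeneous `p` of degree `k` with
`Dp(x)(F₁x) − F₂p(x) = q(x)` for all `x`. -/
theorem homological_operator_invertible {d m : ℕ} (k : ℕ) (hk : 2 ≤ k)
    (F₁ : Matrix (Fin d) (Fin d) ℝ) (F₂ : Matrix (Fin m) (Fin m) ℝ)
    (hF₁ : ∀ μ : ℂ, ((F₁.map (algebraMap ℝ ℂ)).charpoly.IsRoot μ) → μ.re = 0)
    (hF₂ : ∀ μ : ℂ, ((F₂.map (algebraMap ℝ ℂ)).charpoly.IsRoot μ) → μ.re < 0)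
    (q : Fin m → MvPolynomial (Fin d) ℝ) (hq : ∀ i, (q i).IsHomogeneous k) :
    ∃! p : Fin m → MvPolynomial (Fin d) ℝ,
      (∀ i, (p i).IsHomogeneous k) ∧
      ∀ (x : Fin d → ℝ) (i : Fin m),
        (∑ j, F₁.mulVec x j * eval x (pderiv j (p i)))
          - (∑ l, F₂ i l * eval x (p l))
        = eval x (q i) := by
  let V : Submodule ℝ (Fin m → MvPolynomial (Fin d) ℝ) :=
    Submodule.pi Set.univ fun _ ↦ homogeneousSubmodule (Fin d) ℝ k
  have mem_V (p : Fin m → MvPolynomial (Fin d) ℝ) : p ∈ V ↔ ∀ i, (p i).IsHomogeneous k := by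
    simp [V, Submodule.mem_pi]
  have : FiniteDimensional ℝ V :=
    Module.Finite.iff_fg.2 <| Submodule.fg_pi fun _ ↦ homogeneousSubmodule_fg (Fin d) ℝ k
  have maps : ∀ p ∈ V, homologicalOperator F₁ F₂ p ∈ V := fun p hp ↦ (mem_V _).2 fun i ↦ by
    rw [homologicalOperator_apply]
    refine (((mem_V p).1 hp i).linearDerivation F₁).sub (IsHomogeneous.sum _ _ _ fun l _ ↦ ?_)
    exact (homogeneousSubmodule (Fin d) ℝ k).smul_mem _ ((mem_V p).1 hp l)
  have equation_iff (p : Fin m → MvPolynomial (Fin d) ℝ) :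
      (∀ (x : Fin d → ℝ) (i : Fin m), (∑ j, F₁.mulVec x j * eval x (pderiv j (p i)))
        - (∑ l, F₂ i l * eval x (p l)) = eval x (q i)) ↔ homologicalOperator F₁ F₂ p = q := by
    have eval_operator (x : Fin d → ℝ) (i : Fin m) : eval x (homologicalOperator F₁ F₂ p i) =
        (∑ j, F₁.mulVec x j * eval x (pderiv j (p i))) - ∑ l, F₂ i l * eval x (p l) := by
      simp [homologicalOperator_apply, eval_linearDerivation, smul_eval]
    simp only [← eval_operator]
    exact ⟨fun h ↦ _root_.funext fun i ↦ MvPolynomial.funext fun x ↦ h x i,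
      fun h x i ↦ by rw [h]⟩
  have inj : Function.Injective (homologicalOperator F₁ F₂) := by
    rw [injective_iff_map_eq_zero]
    refine fun p hp ↦ eq_zero_of_linearDerivation_eq_sum_of_re F₁ F₂ hF₁ hF₂ p fun i ↦ ?_
    rw [← sub_eq_zero, ← homologicalOperator_apply, hp, Pi.zero_apply]
  have surj : Function.Surjective ((homologicalOperator F₁ F₂).restrict maps) :=
    LinearMap.injective_iff_surjective.1 fun p p' h ↦
      Subtype.ext (inj (congrArg Subtype.val h))
  obtain ⟨p, hp⟩ := surj ⟨q, (mem_V q).2 hq⟩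
  have hpq : homologicalOperator F₁ F₂ p = q := congrArg Subtype.val hp
  exact ⟨p, ⟨(mem_V _).1 p.2, (equation_iff _).2 hpq⟩,
    fun p' hp' ↦ inj (((equation_iff _).1 hp'.2).trans hpq.symm)⟩
end
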